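/- arXiv:1502.03736 — 6 statements merged into one kernel-verified Lean document; each statement's English description precedes it below -/
import Mathlib

section
/- Fix integers n ≥ 1 and 1 ≤ k ≤ n. There is a constant C > 0, depending only on n and k, with the following property: for every real number c ∈ [0,k], every finite field F with q elements, and every subset S ⊆ Fⁿ such that for each k-dimensional F-linear subspace W of Fⁿ there exists a vector v ∈ Fⁿ with |S ∩ (v + W)| ≥ q^c, one has |S| > C · q^{cn/k}. -/
open Finset in
/-- Any set of fewer than `(e + 1) ^ n` points lies on a hypersurface of degree at most `n * e`. -/
theorem MvPolynomial.exists_ne_zero_eval_eq_zero_of_card_lt {F : Type*} [Field F] {n : ℕ}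
    (S : Finset (Fin n → F)) (e : ℕ) (h : #S < (e + 1) ^ n) :
    ∃ P : MvPolynomial (Fin n) F, P ≠ 0 ∧ P.totalDegree ≤ n * e ∧
      ∀ x ∈ S, MvPolynomial.eval x P = 0 := by
  classical
  let ev : MvPolynomial.restrictDegree (Fin n) F e →ₗ[F] (S → F) :=
    (LinearMap.pi fun x : S => (MvPolynomial.aeval (x : Fin n → F)).toLinearMap) ∘ₗ
      (MvPolynomial.restrictDegree (Fin n) F e).subtype
  have hrank : Module.finrank F (MvPolynomial.restrictDegree (Fin n) F e) = (e + 1) ^ n := by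
    rw [Module.finrank_eq_nat_card_basis (show Module.Basis {s : Fin n →₀ ℕ | ∀ i, s i ≤ e} F
      (MvPolynomial.restrictDegree (Fin n) F e) from MvPolynomial.basisRestrictSupport F _)]
    let E : {s : Fin n →₀ ℕ | ∀ i, s i ≤ e} ≃ (Fin n → Fin (e + 1)) :=
      { toFun := fun s i => ⟨s.1 i, Nat.lt_succ_of_le (s.2 i)⟩
        invFun := fun f => ⟨Finsupp.equivFunOnFinite.symm fun i => (f i : ℕ),
          fun i => Nat.le_of_lt_succ (f i).2⟩
        left_inv := fun s => by ext; rfl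
        right_inv := fun f => by ext; rfl }
    refine (Nat.card_congr E).trans ?_
    simp
  have hker : ev.ker ≠ ⊥ := by
    apply LinearMap.ker_ne_bot_of_finrank_lt
    simpa [hrank] using h
  obtain ⟨P, hP, hP0⟩ := Submodule.exists_mem_ne_zero_of_ne_bot hker
  refine ⟨P, by simpa using hP0, ?_, fun x hx => ?_⟩
  · have hP' := (MvPolynomial.mem_restrictDegree _ _ _).1 P.2
    refine Finset.sup_le fun s hs => ?_
    rw [Finsupp.sum_fintype _ _ fun _ => rfl]
    simpa using Finset.sum_le_sum fun i (_ : i ∈ univ) => hP' s hs i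
  · have hx' : MvPolynomial.aeval x (P : MvPolynomial (Fin n) F) = 0 :=
      congrFun (LinearMap.mem_ker.1 hP) ⟨x, hx⟩
    rwa [MvPolynomial.aeval_eq_eval] at hx'

theorem Polynomial.natDegree_prod_le_and_coeff_prod {ι R : Type*} [CommSemiring R]
    (s : Finset ι) (f : ι → Polynomial R) (d : ι → ℕ) (h : ∀ i, (f i).natDegree ≤ d i) :
    (∏ i ∈ s, f i).natDegree ≤ ∑ i ∈ s, d i ∧
      (∏ i ∈ s, f i).coeff (∑ i ∈ s, d i) = ∏ i ∈ s, (f i).coeff (d i) := by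
  classical
  induction s using Finset.induction_on with
  | empty => simp
  | insert a s ha ih =>
    rw [Finset.prod_insert ha, Finset.sum_insert ha, Finset.prod_insert ha]
    refine ⟨Polynomial.natDegree_mul_le_of_le (h a) ih.1, ?_⟩
    rw [Polynomial.coeff_mul_add_eq_of_natDegree_le (h a) ih.1, ih.2]

open Finset Polynomial in
/-- If the top-degree part of `P` does not vanish at `v`, then `P` has at most `deg P` zeros on any
line of direction `v`. -/
theorem MvPolynomial.card_zeros_on_line_le {F : Type*} [Field F] [Fintype F] [DecidableEq F]
    {n : ℕ} (P : MvPolynomial (Fin n) F) (x v : Fin n → F)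
    (hv : MvPolynomial.eval v (MvPolynomial.homogeneousComponent P.totalDegree P) ≠ 0) :
    #{t : F | MvPolynomial.eval (x + t • v) P = 0} ≤ P.totalDegree := by
  set d := P.totalDegree with hd
  let ℓ : Fin n → F[X] := fun i => Polynomial.C (v i) * Polynomial.X + Polynomial.C (x i)
  let p : F[X] := MvPolynomial.eval₂ Polynomial.C ℓ P
  have hp : p = ∑ s ∈ P.support, Polynomial.C (P.coeff s) * ∏ i, ℓ i ^ s i :=
    MvPolynomial.eval₂_eq' _ _ _
  have hℓ : ∀ (s : Fin n →₀ ℕ) i, (ℓ i ^ s i).natDegree ≤ s i := fun s i =>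
    (natDegree_pow_le_of_le (s i) natDegree_linear_le).trans (mul_one _).le
  have hsum : ∀ s ∈ P.support, ∑ i, s i ≤ d := fun s hs => by
    simpa [Finsupp.sum_fintype] using MvPolynomial.le_totalDegree hs
  have hterm := fun s : Fin n →₀ ℕ =>
    natDegree_prod_le_and_coeff_prod univ (fun i => ℓ i ^ s i) s (hℓ s)
  have hdeg : p.natDegree ≤ d := by
    rw [hp]
    refine natDegree_sum_le_of_forall_le _ _ fun s hs => ?_
    exact (natDegree_C_mul_le _ _).trans ((hterm s).1.trans (hsum s hs))
  have hcoeff : p.coeff d = MvPolynomial.eval v (MvPolynomial.homogeneousComponent d P) := by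
    rw [hp, finsetSum_coeff, MvPolynomial.homogeneousComponent_apply, map_sum, sum_filter]
    refine sum_congr rfl fun s hs => ?_
    rw [Polynomial.coeff_C_mul]
    have hdg : Finsupp.degree s = ∑ i, s i := Finsupp.degree_eq_sum s
    split_ifs with h
    · rw [← h, hdg, (hterm s).2, MvPolynomial.eval_monomial, Finsupp.prod_fintype _ _ (by simp)]
      congr 1
      refine prod_congr rfl fun i _ => ?_
      have := coeff_pow_of_natDegree_le (m := s i) (natDegree_linear_le (a := v i) (b := x i))
      simpa [ℓ] using this
    · rw [coeff_eq_zero_of_natDegree_lt, mul_zero]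
      exact (hterm s).1.trans_lt (lt_of_le_of_ne (hsum s hs) (hdg ▸ h))
  have hp0 : p ≠ 0 := by
    rintro h
    rw [h] at hcoeff
    exact hv (by simpa using hcoeff.symm)
  refine le_trans (card_le_card fun t ht => ?_)
    (p.roots.toFinset_card_le.trans (p.card_roots'.trans hdeg))
  rw [Multiset.mem_toFinset, mem_roots hp0, IsRoot.def, hp, eval_finsetSum]
  have := (mem_filter.1 ht).2
  rw [MvPolynomial.eval_eq'] at this
  rw [← this]
  refine sum_congr rfl fun s _ => ?_
  rw [Polynomial.eval_mul, Polynomial.eval_C, Polynomial.eval_prod]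
  congr 1
  refine prod_congr rfl fun i _ => ?_
  rw [Polynomial.eval_pow]
  congr 1
  simp only [ℓ, Polynomial.eval_add, Polynomial.eval_mul, Polynomial.eval_C, Polynomial.eval_X,
    Pi.add_apply, Pi.smul_apply, smul_eq_mul]
  ring

open Finset in
theorem MvPolynomial.card_zeros_mul_card_le {F : Type*} [Field F] [Fintype F] [DecidableEq F]
    {n : ℕ} {P : MvPolynomial (Fin n) F} (hP : P ≠ 0) :
    (#{v : Fin n → F | MvPolynomial.eval v P = 0} : ℝ) * Fintype.card F ≤
      P.totalDegree * (Fintype.card F : ℝ) ^ n := by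
  have h := MvPolynomial.schwartz_zippel_totalDegree hP (univ : Finset F)
  have hq : (0 : ℚ≥0) < Fintype.card F := by exact_mod_cast Fintype.card_pos
  rw [card_univ, div_le_div_iff₀ (by positivity) hq, Fintype.piFinset_univ] at h
  exact_mod_cast h

open Finset in
/-- The Kakeya-type bound for weights `g ≤ 1`: the polynomial method is applied to each level set
`16 ^ (-(j + 1)) < g ≤ 16 ^ (-j)`, and a direction is chosen at which none of the top-degree parts
vanish. -/
theorem exists_direction_sum_line_le {F : Type*} [Field F] [Fintype F] {n : ℕ} (hn : 2 ≤ n)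
    (g : (Fin n → F) → ℝ) (hg0 : ∀ x, 0 ≤ g x) (hg1 : ∀ x, g x ≤ 1) {m : ℝ} (hm : 0 ≤ m)
    (hgm : 16 * ∑ x, g x ≤ (m / (16 * n)) ^ n) :
    ∃ v : Fin n → F, v ≠ 0 ∧ ∀ x, ∑ t : F, g (x + t • v) ≤ m := by
  classical
  have hn0 : (0 : ℝ) < n := by exact_mod_cast (by omega : 0 < n)
  set q : ℝ := (Fintype.card F : ℝ) with hq
  have hq0 : 0 < q := by
    rw [hq]
    exact_mod_cast Fintype.card_pos
  set a : ℝ := m / (16 * n) with ha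
  have ha0 : 0 ≤ a := by positivity
  have hna : n * a = m / 16 := by rw [ha]; field_simp
  have hlvl : ∀ x, ∃ j : ℕ, 0 < g x → (1 / 16 : ℝ) ^ (j + 1) < g x ∧ g x ≤ (1 / 16) ^ j := by
    intro x
    by_cases hx : 0 < g x
    · obtain ⟨j, hj⟩ := exists_nat_pow_near_of_lt_one hx (hg1 x)
        (by norm_num : (0 : ℝ) < 1 / 16) (by norm_num)
      exact ⟨j, fun _ => hj⟩
    · exact ⟨0, fun h => absurd h hx⟩
  choose lvl hlvl using hlvl
  let J := univ.sup lvl + 1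
  have hJ : ∀ x, lvl x < J := fun x => Nat.lt_succ_of_le (le_sup (mem_univ x))
  let S : ℕ → Finset (Fin n → F) := fun j => {x | 0 < g x ∧ lvl x = j}
  have hcard : ∀ j, #(S j) < (⌊4 ^ j * a⌋₊ + 1) ^ n := by
    intro j
    have h1 : #(S j) * (1 / 16 : ℝ) ^ (j + 1) ≤ ∑ x, g x := by
      rw [← nsmul_eq_mul]
      refine (card_nsmul_le_sum (S j) g _ fun x hx => ?_).trans
        (sum_le_sum_of_subset_of_nonneg (subset_univ _) fun x _ _ => hg0 x)
      obtain ⟨hpos, rfl⟩ := (mem_filter.1 hx).2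
      exact (hlvl x hpos).1.le
    have h2 : (#(S j) : ℝ) ≤ 16 ^ j * a ^ n := by
      calc (#(S j) : ℝ) = 16 ^ j * (16 * (#(S j) * (1 / 16 : ℝ) ^ (j + 1))) := by
            rw [one_div, inv_pow, pow_succ]; field_simp
        _ ≤ 16 ^ j * (16 * ∑ x, g x) := by gcongr
        _ ≤ 16 ^ j * a ^ n := by gcongr
    have h3 : (16 : ℝ) ^ j ≤ (4 ^ j) ^ n := by
      calc (16 : ℝ) ^ j = (4 ^ j) ^ 2 := by rw [← pow_mul, mul_comm, pow_mul]; norm_num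
        _ ≤ (4 ^ j) ^ n := pow_le_pow_right₀ (one_le_pow₀ (by norm_num)) hn
    have h4 : (#(S j) : ℝ) < (⌊4 ^ j * a⌋₊ + 1 : ℝ) ^ n := by
      calc (#(S j) : ℝ) ≤ (4 ^ j) ^ n * a ^ n := h2.trans (by gcongr)
        _ = (4 ^ j * a) ^ n := (mul_pow _ _ _).symm
        _ < _ := pow_lt_pow_left₀ (Nat.lt_floor_add_one _) (by positivity) (by omega)
    exact_mod_cast h4
  choose P hP0 hPdeg hPS using fun j =>
    MvPolynomial.exists_ne_zero_eval_eq_zero_of_card_lt (S j) _ (hcard j)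
  have hPdeg' : ∀ j, ((P j).totalDegree : ℝ) ≤ 4 ^ j * m / 16 := by
    intro j
    calc ((P j).totalDegree : ℝ) ≤ n * ⌊4 ^ j * a⌋₊ := by exact_mod_cast hPdeg j
      _ ≤ n * (4 ^ j * a) := by gcongr; exact Nat.floor_le (by positivity)
      _ = 4 ^ j * (n * a) := by ring
      _ = _ := by rw [hna]; ring
  let T : ℕ → MvPolynomial (Fin n) F := fun j =>
    MvPolynomial.homogeneousComponent (P j).totalDegree (P j)
  have hT0 : ∀ j, T j ≠ 0 := fun j => by
    obtain ⟨s, hs, hs'⟩ := exists_mem_eq_sup (P j).support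
      (MvPolynomial.support_nonempty.2 (hP0 j)) fun s => s.sum fun _ e => e
    refine MvPolynomial.ne_zero_iff.2 ⟨s, ?_⟩
    rw [MvPolynomial.coeff_homogeneousComponent, if_pos]
    · exact MvPolynomial.mem_support_iff.1 hs
    · exact hs'.symm
  let Z : ℕ → Finset (Fin n → F) := fun j => {v | MvPolynomial.eval v (T j) = 0}
  let G : Finset ℕ := {j ∈ range J | m * 8 ^ j / 2 ≤ q}
  have hgeom : ∑ j ∈ range J, (1 / 2 : ℝ) ^ j ≤ 2 := sum_geometric_two_le J
  have hZ : ∀ j ∈ G, (#(Z j) : ℝ) ≤ (1 / 2) ^ j * (q ^ n / 8) := by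
    intro j hj
    have hj := (mem_filter.1 hj).2
    have h1 := MvPolynomial.card_zeros_mul_card_le (hT0 j)
    have h2 : ((T j).totalDegree : ℝ) ≤ 4 ^ j * m / 16 := le_trans
      (by exact_mod_cast (MvPolynomial.homogeneousComponent_isHomogeneous _ _).totalDegree_le)
      (hPdeg' j)
    have h3 : 4 ^ j * m / 16 ≤ (1 / 2) ^ j * (q / 8) := by
      have : (4 : ℝ) ^ j = (1 / 2) ^ j * 8 ^ j := by rw [← mul_pow]; norm_num
      rw [this]
      have : (0 : ℝ) < (1 / 2) ^ j := by positivity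
      nlinarith
    refine le_of_mul_le_mul_right ?_ hq0
    calc (#(Z j) : ℝ) * q ≤ (T j).totalDegree * q ^ n := h1
      _ ≤ (1 / 2) ^ j * (q / 8) * q ^ n := by gcongr; exact h2.trans h3
      _ = _ := by ring
  obtain ⟨v, hv⟩ : ∃ v, v ∉ insert 0 (G.biUnion Z) := by
    by_contra! hall
    have h1 : (q ^ n : ℝ) = #(insert 0 (G.biUnion Z)) := by
      rw [eq_univ_iff_forall.2 hall, card_univ]; simp [hq]
    have h2 : (#(insert 0 (G.biUnion Z)) : ℝ) ≤ ∑ j ∈ G, (#(Z j) : ℝ) + 1 := by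
      exact_mod_cast (card_insert_le _ _).trans (Nat.succ_le_succ card_biUnion_le)
    have h3 : ∑ j ∈ G, (#(Z j) : ℝ) ≤ 2 * (q ^ n / 8) := by
      calc ∑ j ∈ G, (#(Z j) : ℝ) ≤ ∑ j ∈ G, (1 / 2) ^ j * (q ^ n / 8) := sum_le_sum hZ
        _ ≤ ∑ j ∈ range J, (1 / 2) ^ j * (q ^ n / 8) :=
          sum_le_sum_of_subset_of_nonneg (filter_subset _ _) fun _ _ _ => by positivity
        _ ≤ _ := by rw [← sum_mul]; gcongr
    have h4 : (2 : ℝ) ≤ q := by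
      rw [hq]
      exact_mod_cast Fintype.one_lt_card (α := F)
    have h5 : q ≤ q ^ n := le_self_pow₀ (by linarith) (by omega)
    linarith
  rw [mem_insert, mem_biUnion, not_or] at hv
  push Not at hv
  refine ⟨v, hv.1, fun x => ?_⟩
  have hline : ∀ j ∈ range J, (#{t : F | x + t • v ∈ S j} : ℝ) ≤ m * 8 ^ j / 2 := by
    intro j hj
    by_cases hjG : m * 8 ^ j / 2 ≤ q
    · have hvj : MvPolynomial.eval v (T j) ≠ 0 := fun h =>
        hv.2 j (mem_filter.2 ⟨hj, hjG⟩) (mem_filter.2 ⟨mem_univ _, h⟩)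
      have h1 : #{t : F | x + t • v ∈ S j} ≤ (P j).totalDegree :=
        (card_le_card fun t ht => by
          rw [mem_filter] at ht ⊢
          exact ⟨ht.1, hPS j _ ht.2⟩).trans (MvPolynomial.card_zeros_on_line_le (P j) x v hvj)
      have h2 : (4 : ℝ) ^ j ≤ 8 ^ j := pow_le_pow_left₀ (by norm_num) (by norm_num) j
      have h3 : (#{t : F | x + t • v ∈ S j} : ℝ) ≤ (P j).totalDegree := by exact_mod_cast h1
      have h4 : 4 ^ j * m ≤ 8 ^ j * m := by gcongr
      have h5 : 0 ≤ 8 ^ j * m := by positivity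
      linarith [hPdeg' j]
    · refine le_trans ?_ (not_le.1 hjG).le
      rw [hq]
      exact_mod_cast card_le_univ _
  have hpt : ∀ y, g y ≤ ∑ j ∈ range J, if y ∈ S j then (1 / 16 : ℝ) ^ j else 0 := by
    intro y
    have hnn : ∀ j ∈ range J, (0 : ℝ) ≤ if y ∈ S j then (1 / 16 : ℝ) ^ j else 0 := by
      intro j _; positivity
    by_cases hy : 0 < g y
    · refine (hlvl y hy).2.trans ?_
      refine le_trans (le_of_eq ?_) (single_le_sum hnn (mem_range.2 (hJ y)))
      rw [if_pos (mem_filter.2 ⟨mem_univ _, hy, rfl⟩)]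
    · exact (not_lt.1 hy).trans (sum_nonneg hnn)
  calc ∑ t : F, g (x + t • v)
      ≤ ∑ t : F, ∑ j ∈ range J, if x + t • v ∈ S j then (1 / 16 : ℝ) ^ j else 0 :=
        sum_le_sum fun t _ => hpt _
    _ = ∑ j ∈ range J, (#{t : F | x + t • v ∈ S j} : ℝ) * (1 / 16) ^ j := by
        rw [sum_comm]
        refine sum_congr rfl fun j _ => ?_
        rw [← sum_filter, sum_const, nsmul_eq_mul]
    _ ≤ ∑ j ∈ range J, m * 8 ^ j / 2 * (1 / 16) ^ j := by
        gcongr with j hj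
        exact hline j hj
    _ = (∑ j ∈ range J, (1 / 2 : ℝ) ^ j) * (m / 2) := by
        rw [sum_mul]
        refine sum_congr rfl fun j _ => ?_
        have : (1 / 2 : ℝ) ^ j = 8 ^ j * (1 / 16) ^ j := by rw [← mul_pow]; norm_num
        rw [this]; ring
    _ ≤ 2 * (m / 2) := by gcongr
    _ = m := by ring

open Finset in
theorem sum_line_le_sum {F V : Type*} [Field F] [Fintype F] [AddCommGroup V] [Module F V]
    [Fintype V] {g : V → ℝ} (hg0 : ∀ x, 0 ≤ g x) {v : V} (hv : v ≠ 0) (x : V) :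
    ∑ t : F, g (x + t • v) ≤ ∑ y, g y := by
  classical
  have hinj : Function.Injective fun t : F => x + t • v :=
    (add_right_injective x).comp (smul_left_injective F hv)
  rw [← sum_image (f := g) hinj.injOn]
  exact sum_le_sum_of_subset_of_nonneg (subset_univ _) fun y _ _ => hg0 y

theorem exists_direction_sum_line_pow_le {F V : Type*} [Field F] [Fintype F] [AddCommGroup V]
    [Module F V] [Fintype V] {n : ℕ} (hn : 1 ≤ n) (hV : Module.finrank F V = n)
    {g : V → ℝ} {M : ℝ} (hg0 : ∀ x, 0 ≤ g x) (hgM : ∀ x, g x ≤ M) :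
    ∃ v : V, v ≠ 0 ∧ ∀ x, (∑ t : F, g (x + t • v)) ^ n ≤
      16 * (16 * n) ^ n * (M ^ (n - 1) * ∑ x, g x) := by
  have hM0 : 0 ≤ M := (hg0 0).trans (hgM 0)
  have hN0 : 0 ≤ ∑ x, g x := Finset.sum_nonneg fun x _ => hg0 x
  obtain hM | hM := hM0.eq_or_lt
  · have hg : ∀ x, g x = 0 := fun x => le_antisymm (hM ▸ hgM x) (hg0 x)
    have : Nontrivial V := Module.nontrivial_of_finrank_pos (R := F) (by omega)
    obtain ⟨v, hv⟩ := exists_ne (0 : V)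
    refine ⟨v, hv, fun x => ?_⟩
    have hn' : n ≠ 0 := by omega
    simp [hg, zero_pow hn']
  obtain rfl | hn2 := hn.eq_or_lt
  · have : Nontrivial V := Module.nontrivial_of_finrank_pos (R := F) (by omega)
    obtain ⟨v, hv⟩ := exists_ne (0 : V)
    refine ⟨v, hv, fun x => ?_⟩
    have := sum_line_le_sum (F := F) hg0 hv x
    norm_num
    linarith
  have : Module.Finite F V := Module.Finite.of_finite
  let e : V ≃ₗ[F] (Fin n → F) := LinearEquiv.ofFinrankEq _ _ (by simp [hV])
  let N : ℝ := ∑ x, g (e.symm x) / M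
  have hN : N = (∑ x, g x) / M := by
    rw [Finset.sum_div]
    exact e.symm.toEquiv.sum_comp fun x => g x / M
  have hN' : 0 ≤ N := by rw [hN]; positivity
  have hn0 : (0 : ℝ) < n := by exact_mod_cast (by omega : 0 < n)
  have hpow : ((16 * (16 * n) ^ n * N) ^ (n⁻¹ : ℝ)) ^ n = 16 * (16 * n) ^ n * N :=
    Real.rpow_inv_natCast_pow (by positivity) (by omega)
  obtain ⟨v, hv, hline⟩ := exists_direction_sum_line_le hn2 (fun x => g (e.symm x) / M)
    (fun x => div_nonneg (hg0 _) hM0) (fun x => (div_le_one hM).2 (hgM _))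
    (m := (16 * (16 * n) ^ n * N) ^ (n⁻¹ : ℝ)) (by positivity) (by
      rw [div_pow, hpow]
      apply le_of_eq
      field_simp
      rfl)
  refine ⟨e.symm v, by simpa using hv, fun x => ?_⟩
  have h := hline (e x)
  simp only [map_add, map_smul, e.symm_apply_apply] at h
  rw [← Finset.sum_div] at h
  have h' := pow_le_pow_left₀
    (div_nonneg (Finset.sum_nonneg fun t _ => hg0 _) hM0) h n
  rw [hpow, div_pow, div_le_iff₀ (by positivity), hN] at h'
  refine h'.trans (le_of_eq ?_)
  obtain ⟨n, rfl⟩ : ∃ k, n = k + 1 := ⟨n - 1, by omega⟩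
  rw [Nat.add_sub_cancel, pow_succ M]
  field_simp

open Classical Finset in
/-- A weight bounded by `M` has a `k`-dimensional direction all of whose cosets are light, found by
quotienting out one line at a time. -/
theorem exists_submodule_sum_coset_pow_le (k n : ℕ) (hkn : k ≤ n) :
    ∃ C : ℝ, 1 ≤ C ∧ ∀ (F : Type*) [Field F] [Fintype F] (V : Type*) [AddCommGroup V]
      [Module F V] [Fintype V] (_ : Module.finrank F V = n) (g : V → ℝ) (M : ℝ)
      (_ : ∀ x, 0 ≤ g x) (_ : ∀ x, g x ≤ M),
      ∃ W : Submodule F V, Module.finrank F W = k ∧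
        ∀ v, (∑ x with x - v ∈ W, g x) ^ n ≤ C * (M ^ (n - k) * (∑ x, g x) ^ k) := by
  induction k generalizing n with
  | zero =>
    refine ⟨1, le_rfl, fun F _ _ V _ _ _ _ g M hg0 hgM => ⟨⊥, finrank_bot F V, fun v => ?_⟩⟩
    simp only [Submodule.mem_bot, sub_eq_zero, Nat.sub_zero, pow_zero, mul_one, one_mul]
    rw [filter_eq' univ v, if_pos (mem_univ v), sum_singleton]
    exact pow_le_pow_left₀ (hg0 v) (hgM v) n
  | succ k ih =>
    obtain ⟨n, rfl⟩ : ∃ l, n = l + 1 := ⟨n - 1, by omega⟩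
    obtain ⟨C, hC, ih⟩ := ih n (by omega)
    obtain ⟨K, hK⟩ : ∃ K : ℝ, K = 16 * (16 * ((n + 1 : ℕ) : ℝ)) ^ (n + 1) := ⟨_, rfl⟩
    have hK1 : 1 ≤ K := by
      have : (1 : ℝ) ≤ (16 * ((n + 1 : ℕ) : ℝ)) ^ (n + 1) := by
        refine one_le_pow₀ ?_
        push_cast
        linarith [(Nat.cast_nonneg n : (0 : ℝ) ≤ n)]
      linarith
    have hCK : 1 ≤ C ^ (n + 1) * K ^ (n - k) := one_le_mul_of_one_le_of_one_le
      (one_le_pow₀ hC) (one_le_pow₀ hK1)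
    refine ⟨C ^ (n + 1) * K ^ (n - k), hCK, fun F _ _ V _ _ _ hV g M hg0 hgM => ?_⟩
    have hM0 : 0 ≤ M := (hg0 0).trans (hgM 0)
    have hN0 : 0 ≤ ∑ x, g x := sum_nonneg fun x _ => hg0 x
    have : Module.Finite F V := Module.Finite.of_finite
    obtain ⟨u, hu, hline⟩ := exists_direction_sum_line_pow_le (Nat.le_add_left 1 n) hV hg0 hgM
    rw [← hK, Nat.add_sub_cancel] at hline
    let L := Submodule.span F {u}
    have hL : Module.finrank F L = 1 := finrank_span_singleton hu
    let _ : Fintype (V ⧸ L) := Fintype.ofFinite _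
    have hQ : Module.finrank F (V ⧸ L) = n := by
      have := L.finrank_quotient_add_finrank
      omega
    let g' : V ⧸ L → ℝ := fun y => ∑ x with L.mkQ x = y, g x
    have hg'0 : ∀ y, 0 ≤ g' y := fun y => sum_nonneg fun x _ => hg0 x
    obtain ⟨y₀, hy₀⟩ := Finite.exists_max g'
    obtain ⟨W, hW, hWsum⟩ := ih F (V ⧸ L) hQ g' (g' y₀) hg'0 hy₀
    have hsum : ∑ y, g' y = ∑ x, g x := sum_fiberwise _ _ _
    have hmax : g' y₀ ^ (n + 1) ≤ K * (M ^ n * ∑ x, g x) := by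
      obtain ⟨x₀, rfl⟩ := L.mkQ_surjective y₀
      refine le_trans (pow_le_pow_left₀ (hg'0 _) ?_ _) (hline x₀)
      have hinj : Function.Injective fun t : F => x₀ + t • u :=
        (add_right_injective x₀).comp (smul_left_injective F hu)
      rw [← sum_image (f := g) hinj.injOn]
      refine sum_le_sum_of_subset_of_nonneg (fun x hx => ?_) fun x _ _ => hg0 x
      have hx : x - x₀ ∈ L := (Submodule.Quotient.eq L).1 (mem_filter.1 hx).2
      obtain ⟨t, ht⟩ := Submodule.mem_span_singleton.1 hx
      exact mem_image.2 ⟨t, mem_univ _, by rw [ht]; abel⟩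
    refine ⟨W.comap L.mkQ, ?_, fun v => ?_⟩
    · have hmap : (W.comap L.mkQ).map L.mkQ = W :=
        Submodule.map_comap_eq_of_surjective L.mkQ_surjective W
      have h1 := (Submodule.quotientQuotientEquivQuotient L (W.comap L.mkQ)
        (L.le_comap_mkQ W)).finrank_eq
      rw [hmap] at h1
      have h2 := W.finrank_quotient_add_finrank
      have h3 := (W.comap L.mkQ).finrank_quotient_add_finrank
      omega
    have hcoset : ∑ x with x - v ∈ W.comap L.mkQ, g x = ∑ y with y - L.mkQ v ∈ W, g' y := by
      rw [← sum_fiberwise_of_maps_to (g := L.mkQ) (t := {y | y - L.mkQ v ∈ W})]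
      · refine sum_congr rfl fun y hy => sum_congr ?_ fun _ _ => rfl
        ext x
        simp only [mem_filter, mem_univ, true_and, Submodule.mem_comap, map_sub] at hy ⊢
        exact ⟨And.right, fun h => ⟨h ▸ hy, h⟩⟩
      · intro x hx
        exact mem_filter.2 ⟨mem_univ _, by simpa using hx⟩
    set m := ∑ x with x - v ∈ W.comap L.mkQ, g x with hm
    have hm0 : 0 ≤ m := sum_nonneg fun x _ => hg0 x
    have hmN : m ≤ ∑ x, g x :=
      sum_le_sum_of_subset_of_nonneg (subset_univ _) fun x _ _ => hg0 x
    have hmpow : m ^ n ≤ C * (g' y₀ ^ (n - k) * (∑ x, g x) ^ k) := by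
      rw [hcoset, ← hsum]
      exact hWsum _
    rw [Nat.add_sub_add_right]
    obtain rfl | hn := n.eq_zero_or_pos
    · obtain rfl : k = 0 := by omega
      simp only [zero_add, pow_one, Nat.sub_zero, pow_zero, mul_one, one_mul] at hCK ⊢
      exact hmN.trans (le_mul_of_one_le_left hN0 hC)
    refine le_of_pow_le_pow_left₀ hn.ne' (by positivity) ?_
    set N := ∑ x, g x
    have hexp : n - k + k * (n + 1) = (k + 1) * n := by
      obtain ⟨l, rfl⟩ := Nat.exists_eq_add_of_le (by omega : k ≤ n)
      rw [Nat.add_sub_cancel_left]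
      ring
    calc (m ^ (n + 1)) ^ n = (m ^ n) ^ (n + 1) := by rw [← pow_mul, ← pow_mul, mul_comm]
      _ ≤ (C * (g' y₀ ^ (n - k) * N ^ k)) ^ (n + 1) := by gcongr
      _ = C ^ (n + 1) * ((g' y₀ ^ (n + 1)) ^ (n - k) * N ^ (k * (n + 1))) := by
        rw [mul_pow, mul_pow, ← pow_mul, ← pow_mul, ← pow_mul, mul_comm (n - k)]
      _ ≤ C ^ (n + 1) * ((K * (M ^ n * N)) ^ (n - k) * N ^ (k * (n + 1))) := by
        have := hg'0 y₀
        gcongr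
      _ = (C ^ (n + 1) * K ^ (n - k)) * ((M ^ (n - k)) ^ n * N ^ (n - k + k * (n + 1))) := by
        rw [mul_pow, mul_pow, ← pow_mul, ← pow_mul, mul_comm n (n - k), pow_add]
        ring
      _ ≤ (C ^ (n + 1) * K ^ (n - k)) ^ n * ((M ^ (n - k)) ^ n * N ^ (n - k + k * (n + 1))) := by
        gcongr
        exact le_self_pow₀ hCK hn.ne'
      _ = _ := by rw [hexp, pow_mul]; ring

/-- **k-plane Furstenberg set bound over finite fields** (Proposition 1.4).
If `S ⊆ Fⁿ` contains, for every `k`-dimensional direction `W`, a coset `v + W`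
meeting `S` in at least `q^c` points, then `|S| > C·q^{cn/k}`. -/
theorem kplane_furstenberg_sets (n k : ℕ) (hn : 1 ≤ n) (hk1 : 1 ≤ k) (hkn : k ≤ n) :
    ∃ C : ℝ, 0 < C ∧
      ∀ (c : ℝ), 0 ≤ c → c ≤ (k : ℝ) →
      ∀ (F : Type) [Field F] [Fintype F],
      ∀ S : Set (Fin n → F),
        (∀ W : Submodule F (Fin n → F), Module.finrank F W = k →
          ∃ v : Fin n → F,
            (Fintype.card F : ℝ) ^ c ≤
              (Nat.card ({x | x ∈ S ∧ x - v ∈ W} : Set (Fin n → F)) : ℝ)) →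
        C * (Fintype.card F : ℝ) ^ (c * n / k) < (Nat.card S : ℝ) := by
  classical
  obtain ⟨C, hC, h⟩ := exists_submodule_sum_coset_pow_le k n hkn
  refine ⟨1 / (2 * C), by positivity, fun c _ _ F _ _ S hS => ?_⟩
  obtain ⟨W, hW, hsum⟩ := h F (Fin n → F) (by simp) (S.indicator 1) 1
    (fun x => Set.indicator_nonneg (fun _ _ => zero_le_one) x)
    (fun x => Set.indicator_le_self' (fun _ _ => zero_le_one) x)
  obtain ⟨v, hv⟩ := hS W hW
  have hcoset : ∑ x with x - v ∈ W, S.indicator (1 : (Fin n → F) → ℝ) x =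
      Nat.card ({x | x ∈ S ∧ x - v ∈ W} : Set (Fin n → F)) := by
    rw [Nat.card_eq_fintype_card, Fintype.card_subtype]
    simp [Set.indicator_apply, Finset.filter_filter, and_comm]
  have htotal : ∑ x, S.indicator (1 : (Fin n → F) → ℝ) x = Nat.card S := by
    rw [Nat.card_eq_fintype_card, Fintype.card_subtype]
    simp [Set.indicator_apply]
  have hq : (0 : ℝ) < Fintype.card F := by exact_mod_cast Fintype.card_pos
  have hk : (k : ℝ) ≠ 0 := by exact_mod_cast (by omega : k ≠ 0)
  have hle := (pow_le_pow_left₀ (by positivity) hv n).trans (hcoset ▸ hsum v)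
  rw [htotal, one_pow, one_mul, ← Real.rpow_mul_natCast hq.le] at hle
  set N : ℝ := (Nat.card S : ℝ)
  have hbound : (Fintype.card F : ℝ) ^ (c * n / k) ≤ C * N := by
    refine le_of_pow_le_pow_left₀ (by omega : k ≠ 0) (by positivity) ?_
    rw [← Real.rpow_mul_natCast hq.le, div_mul_cancel₀ _ hk, mul_pow]
    refine hle.trans ?_
    gcongr
    exact le_self_pow₀ hC (by omega)
  have hpos : (0 : ℝ) < (Fintype.card F : ℝ) ^ (c * n / k) := Real.rpow_pos_of_pos hq _
  rw [one_div, inv_mul_lt_iff₀ (by positivity)]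
  linarith
end

section
/- Fix integers n ≥ 1 and 1 ≤ k ≤ n. There is a constant C > 0, depending only on n and k, with the following property: for every real number c ∈ [0,k], every finite field F with q elements, and every ideal I ⊆ F[x₁,…,xₙ] such that N := dim_F F[x₁,…,xₙ]/I is finite, if for each k-dimensional F-linear subspace W of Fⁿ there exists v ∈ Fⁿ with dim_F F[x₁,…,xₙ]/(I + I_{v+W}) ≥ q^c, then N > C · q^{cn/k}. -/
open MvPolynomial

/-- The ideal of an affine subspace `V ⊆ 𝕜ⁿ`: generated by all polynomials of
total degree at most 1 vanishing identically on `V`. -/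
noncomputable def affineSubspaceIdeal (F : Type) [Field F] (n : ℕ)
    (V : Set (Fin n → F)) : Ideal (MvPolynomial (Fin n) F) :=
  Ideal.span {f : MvPolynomial (Fin n) F |
    f.totalDegree ≤ 1 ∧ ∀ x ∈ V, MvPolynomial.eval x f = 0}

open Module in
theorem sum_finrank_eigenspace_le {F M : Type*} [Field F] [Fintype F] [AddCommGroup M]
    [Module F M] [FiniteDimensional F M] (f : Module.End F M) :
    ∑ μ : F, finrank F (f.eigenspace μ) ≤ finrank F M := by
  classical
  have h := (f.eigenspaces_iSupIndep).dfinsupp_lsum_injective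
  have h2 := LinearMap.finrank_le_finrank_of_injective h
  change finrank F (DirectSum F fun μ => f.eigenspace μ) ≤ _ at h2
  rwa [Module.finrank_directSum] at h2

open Module in
theorem card_mul_finrank_range_le {F M M' : Type*} [Field F] [Fintype F] [DecidableEq F]
    [AddCommGroup M] [Module F M] [FiniteDimensional F M] [AddCommGroup M'] [Module F M']
    [FiniteDimensional F M'] (S B : M →ₗ[F] M') :
    ∑ _u ∈ Finset.univ.erase (0 : F), finrank F (LinearMap.range S) ≤
      ∑ u ∈ Finset.univ.erase (0 : F), finrank F (LinearMap.range (S + u • B)) +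
        finrank F (LinearMap.range S) := by
  obtain ⟨i, hi⟩ := S.rangeRestrict.exists_rightInverse_of_surjective
    (LinearMap.range_eq_top.2 S.surjective_rangeRestrict)
  obtain ⟨p, hp⟩ := (LinearMap.range S).subtype.exists_leftInverse_of_injective
    (Submodule.ker_subtype _)
  set B' : Module.End F (LinearMap.range S) := p ∘ₗ B ∘ₗ i with hB'
  have hSi : ∀ x, S (i x) = x := fun x => congrArg Subtype.val (LinearMap.congr_fun hi x)
  have hpx : ∀ x : LinearMap.range S, p x = x := fun x => LinearMap.congr_fun hp x
  have key : ∀ u ∈ Finset.univ.erase (0 : F), finrank F (LinearMap.range S) ≤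
      finrank F (LinearMap.range (S + u • B)) + finrank F (B'.eigenspace (-u⁻¹)) := by
    intro u hu
    have hu0 : u ≠ 0 := Finset.ne_of_mem_erase hu
    have e : p ∘ₗ (S + u • B) ∘ₗ i = 1 + u • B' := by
      ext x
      simp [hB', hSi, hpx]
    have hker : LinearMap.ker (1 + u • B') ≤ B'.eigenspace (-u⁻¹) := by
      intro x hx
      rw [Module.End.mem_eigenspace_iff]
      have hx' : x + u • B' x = 0 := by simpa using hx
      have : u⁻¹ • (x + u • B' x) = 0 := by rw [hx', smul_zero]
      rw [smul_add, smul_smul, inv_mul_cancel₀ hu0, one_smul] at this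
      rw [neg_smul]
      exact eq_neg_of_add_eq_zero_right this
    have h1 := LinearMap.finrank_range_add_finrank_ker (1 + u • B')
    have h2 : finrank F (LinearMap.range (1 + u • B')) ≤
        finrank F (LinearMap.range (S + u • B)) := by
      rw [← e, LinearMap.range_comp]
      refine (Submodule.finrank_map_le _ _).trans (Submodule.finrank_mono ?_)
      exact LinearMap.range_comp_le_range _ _
    have h3 := Submodule.finrank_mono hker
    omega
  have hsum : ∑ u ∈ Finset.univ.erase (0 : F), finrank F (B'.eigenspace (-u⁻¹)) ≤
      finrank F (LinearMap.range S) := by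
    refine le_trans ?_ (sum_finrank_eigenspace_le B')
    refine (Finset.sum_le_sum_of_subset (Finset.erase_subset _ _)).trans (le_of_eq ?_)
    exact Equiv.sum_comp ((Equiv.inv F).trans (Equiv.neg F))
      (fun v => finrank F (B'.eigenspace v))
  calc _ ≤ ∑ u ∈ Finset.univ.erase (0 : F), (finrank F (LinearMap.range (S + u • B)) +
        finrank F (B'.eigenspace (-u⁻¹))) := Finset.sum_le_sum key
    _ ≤ _ := by rw [Finset.sum_add_distrib]; omega

open Module in
theorem finrank_sup_finset_sup_le {F M ι : Type*} [Field F] [AddCommGroup M] [Module F M]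
    [FiniteDimensional F M] (L : Submodule F M) (U : ι → Submodule F M) (s : Finset ι) :
    (finrank F ↥(L ⊔ s.sup U) : ℝ) ≤
      finrank F L + ∑ i ∈ s, ((finrank F ↥(L ⊔ U i) : ℝ) - finrank F L) := by
  classical
  induction s using Finset.induction_on with
  | empty => rw [Finset.sup_empty, sup_bot_eq]; simp
  | insert a s ha ih =>
    rw [Finset.sup_insert, Finset.sum_insert ha]
    have h := Submodule.finrank_sup_add_finrank_inf_eq (L ⊔ U a) (L ⊔ s.sup U)
    have h2 : finrank F L ≤ finrank F ↥((L ⊔ U a) ⊓ (L ⊔ s.sup U)) :=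
      Submodule.finrank_mono (le_inf le_sup_left le_sup_left)
    rw [← sup_sup_distrib_left] at h
    have h' : (finrank F ↥(L ⊔ (U a ⊔ s.sup U)) : ℝ) + finrank F L ≤
      finrank F ↥(L ⊔ U a) + finrank F ↥(L ⊔ s.sup U) := by exact_mod_cast (by omega)
    linarith

/-- The principal ideal generated by `x`, as a subspace. -/
def principalSubspace (F : Type*) {A : Type*} [Field F] [CommRing A] [Algebra F A] (x : A) :
    Submodule F A := LinearMap.range (LinearMap.mulLeft F x)

section principal

variable {F A : Type*} [Field F] [CommRing A] [Algebra F A]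

theorem mem_principalSubspace {x z : A} : z ∈ principalSubspace F x ↔ x ∣ z := by
  simp [principalSubspace, dvd_def, eq_comm]

open Module in
theorem finrank_principalSubspace_sup_le [FiniteDimensional F A] (a b : A) :
    finrank F ↥(principalSubspace F a ⊔ principalSubspace F b) +
      finrank F (principalSubspace F (a * b)) ≤
    finrank F (principalSubspace F a) + finrank F (principalSubspace F b) := by
  rw [← Submodule.finrank_sup_add_finrank_inf_eq (principalSubspace F a) (principalSubspace F b)]
  refine Nat.add_le_add_left (Submodule.finrank_mono ?_) _
  intro z hz
  rw [mem_principalSubspace] at hz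
  exact ⟨mem_principalSubspace.2 (dvd_of_mul_right_dvd hz),
    mem_principalSubspace.2 (dvd_of_mul_left_dvd hz)⟩

theorem principalSubspace_sup_le (a b c : A) (h : a ∣ c - b) :
    principalSubspace F a ⊔ principalSubspace F c ≤
      principalSubspace F a ⊔ principalSubspace F b := by
  refine sup_le le_sup_left ?_
  intro z hz
  obtain ⟨w, rfl⟩ := mem_principalSubspace.1 hz
  rw [show c * w = (c - b) * w + b * w by ring]
  exact Submodule.add_mem_sup (mem_principalSubspace.2 (h.mul_right w))
    (mem_principalSubspace.2 (dvd_mul_right _ _))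

open Module in
theorem finrank_le_pow_add_finrank_sup [FiniteDimensional F A] {k : ℕ} (l : A) (y : Fin k → A)
    (hgen : Algebra.adjoin F (insert l (Set.range y)) = ⊤) (j : ℕ) :
    finrank F A ≤ j ^ k + finrank F ↥(principalSubspace F l ⊔
      Finset.univ.sup fun i => principalSubspace F (y i ^ j)) := by
  classical
  set Q := principalSubspace F l ⊔ Finset.univ.sup fun i => principalSubspace F (y i ^ j) with hQ
  set T : Submodule F A :=
    Submodule.span F (Set.range fun e : Fin k → Fin j => ∏ i, y i ^ (e i : ℕ)) with hT
  have hlQ : ∀ z, l ∣ z → z ∈ Q := fun z hz => Submodule.mem_sup_left (mem_principalSubspace.2 hz)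
  have hyQ : ∀ i z, y i ^ j ∣ z → z ∈ Q := fun i z hz => Submodule.mem_sup_right
    (Finset.le_sup (f := fun i => principalSubspace F (y i ^ j)) (Finset.mem_univ i)
      (mem_principalSubspace.2 hz))
  have hQmul : ∀ a, ∀ z ∈ Q, a * z ∈ Q := by
    intro a z hz
    have : Q ≤ Q.comap (LinearMap.mulLeft F a) := by
      refine sup_le ?_ (Finset.sup_le fun i _ => ?_)
      · intro w hw
        exact hlQ _ ((mem_principalSubspace.1 hw).mul_left a)
      · intro w hw
        exact hyQ i _ ((mem_principalSubspace.1 hw).mul_left a)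
    exact this hz
  have hmul : ∀ a : A, ∀ z ∈ T ⊔ Q, a * z ∈ T ⊔ Q := by
    intro a
    have ha : a ∈ Algebra.adjoin F (insert l (Set.range y)) := by rw [hgen]; trivial
    induction ha using Algebra.adjoin_induction with
    | algebraMap r => intro z hz; rw [← Algebra.smul_def]; exact Submodule.smul_mem _ _ hz
    | add a b _ _ iha ihb => intro z hz; rw [add_mul]; exact add_mem (iha z hz) (ihb z hz)
    | mul a b _ _ iha ihb => intro z hz; rw [mul_assoc]; exact iha _ (ihb z hz)
    | mem a ha =>
      rcases ha with rfl | ⟨i, rfl⟩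
      · intro z _
        exact Submodule.mem_sup_right (hlQ _ (dvd_mul_right _ _))
      · have : T ⊔ Q ≤ (T ⊔ Q).comap (LinearMap.mulLeft F (y i)) := by
          refine sup_le ?_ fun w hw => Submodule.mem_sup_right (hQmul _ w hw)
          rw [hT, Submodule.span_le]
          rintro _ ⟨e, rfl⟩
          change y i * ∏ i, y i ^ (e i : ℕ) ∈ T ⊔ Q
          have hrest : y i * ∏ i, y i ^ (e i : ℕ) =
              y i ^ ((e i : ℕ) + 1) * ∏ x ∈ Finset.univ.erase i, y x ^ (e x : ℕ) := by
            rw [← Finset.mul_prod_erase _ _ (Finset.mem_univ i), pow_succ]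
            ring
          by_cases h : (e i : ℕ) + 1 < j
          · refine Submodule.mem_sup_left (Submodule.subset_span
              ⟨Function.update e i ⟨_, h⟩, ?_⟩)
            dsimp only
            rw [hrest, ← Finset.mul_prod_erase _ _ (Finset.mem_univ i)]
            simp only [Function.update_self]
            congr 1
            refine Finset.prod_congr rfl fun x hx => ?_
            rw [Function.update_of_ne (Finset.ne_of_mem_erase hx)]
          · have hej : (e i : ℕ) + 1 = j := by have := (e i).2; omega
            refine Submodule.mem_sup_right (hyQ i _ ?_)
            rw [hrest, hej]
            exact dvd_mul_right _ _
        exact fun z hz => this hz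
  have hone : (1 : A) ∈ T ⊔ Q := by
    rcases Nat.eq_zero_or_pos j with rfl | hj
    · rcases Nat.eq_zero_or_pos k with rfl | hk
      · exact Submodule.mem_sup_left (Submodule.subset_span ⟨fun i => i.elim0, by simp⟩)
      · exact Submodule.mem_sup_right (hyQ ⟨0, hk⟩ _ (by simp))
    · exact Submodule.mem_sup_left (Submodule.subset_span ⟨fun _ => ⟨0, hj⟩, by simp⟩)
  have htop : T ⊔ Q = ⊤ := by
    rw [eq_top_iff]
    intro a _
    simpa using hmul a 1 hone
  have hTrank : finrank F T ≤ j ^ k := by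
    have := finrank_range_le_card (R := F) fun e : Fin k → Fin j => ∏ i, y i ^ (e i : ℕ)
    simpa [Set.finrank] using this
  have := Submodule.finrank_add_le_finrank_add_finrank T Q
  rw [htop, finrank_top] at this
  omega

end principal

open Module in
theorem finrank_sup_sub_le {F A : Type*} [Field F] [CommRing A] [Algebra F A]
    [FiniteDimensional F A] (l y : A) {u : F} (hu : u ≠ 0) (j : ℕ) :
    finrank F ↥(principalSubspace F (l + u • y) ⊔ principalSubspace F (y ^ j)) +
      finrank F (principalSubspace F ((l + u • y) * l ^ j)) ≤
    finrank F (principalSubspace F (l + u • y)) + finrank F (principalSubspace F (l ^ j)) := by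
  refine le_trans (Nat.add_le_add_right (Submodule.finrank_mono ?_) _)
    (finrank_principalSubspace_sup_le (l + u • y) (l ^ j))
  refine (principalSubspace_sup_le (l + u • y) (((-u⁻¹) • l) ^ j) (y ^ j) ?_).trans
    (sup_le_sup_left ?_ _)
  · refine dvd_trans ?_ (sub_dvd_pow_sub_pow y ((-u⁻¹) • l) j)
    refine ⟨algebraMap F A u⁻¹, ?_⟩
    rw [mul_comm, ← Algebra.smul_def, smul_add, smul_smul, inv_mul_cancel₀ hu, one_smul, neg_smul]
    ring
  · intro z hz
    rw [mem_principalSubspace] at hz ⊢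
    rw [smul_pow, Algebra.smul_def] at hz
    exact dvd_of_mul_left_dvd hz

theorem averaging_bound {F : Type*} [Field F] [Fintype F] [DecidableEq F] {k : ℕ}
    (a : ℕ → (Fin k → F) → ℝ) (R : Fin k → ℕ → (Fin k → F) → ℝ) (m N : ℝ) (J : ℕ)
    (ha0 : ∀ j s, 0 ≤ a j s) (haN : ∀ j s, a j s ≤ N)
    (h1 : ∀ (j : ℕ) s, m - (j : ℝ) ^ k ≤ ∑ i, R i j s)
    (h2 : ∀ i j s,
      ∑ u ∈ Finset.univ.erase (0 : F), R i j (s + (Pi.single i u : Fin k → F)) ≤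
        ((Fintype.card F : ℝ) - 1) * (a j s - a (j + 1) s) + N) :
    ((Fintype.card F : ℝ) - 1) * J * (m - (J : ℝ) ^ k) ≤
      k * (((Fintype.card F : ℝ) - 1) + J) * N := by
  set q : ℝ := (Fintype.card F : ℝ) with hq
  have hq1 : 1 < q := by rw [hq]; exact_mod_cast Fintype.one_lt_card
  have hcard : ((Finset.univ.erase (0 : F)).card : ℝ) = q - 1 := by
    rw [Finset.card_erase_of_mem (Finset.mem_univ _), Finset.card_univ,
      Nat.cast_sub Fintype.card_pos]
    simp [hq]
  have hcardk : ((Finset.univ : Finset (Fin k → F)).card : ℝ) = q ^ k := by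
    simp [hq]
  have h3 : ∀ j : ℕ, (q - 1) * (q ^ k * (m - (j : ℝ) ^ k)) ≤
      k * ((q - 1) * (∑ s, a j s - ∑ s, a (j + 1) s) + q ^ k * N) := by
    intro j
    have e1 : ∀ i, ∑ s, ∑ u ∈ Finset.univ.erase (0 : F), R i j (s + (Pi.single i u : Fin k → F)) =
        (q - 1) * ∑ s, R i j s := by
      intro i
      rw [Finset.sum_comm]
      have : ∀ u ∈ Finset.univ.erase (0 : F),
          ∑ s, R i j (s + (Pi.single i u : Fin k → F)) = ∑ s, R i j s :=
        fun u _ => Equiv.sum_comp (Equiv.addRight (Pi.single i u : Fin k → F)) (R i j)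
      rw [Finset.sum_congr rfl this, Finset.sum_const, nsmul_eq_mul, hcard]
    have e2 : ∀ i, (q - 1) * ∑ s, R i j s ≤
        (q - 1) * (∑ s, a j s - ∑ s, a (j + 1) s) + q ^ k * N := by
      intro i
      rw [← e1]
      refine (Finset.sum_le_sum fun s _ => h2 i j s).trans (le_of_eq ?_)
      rw [Finset.sum_add_distrib, ← Finset.mul_sum, Finset.sum_sub_distrib, Finset.sum_const,
        nsmul_eq_mul, hcardk]
    have e3 := Finset.sum_le_sum fun i (_ : i ∈ Finset.univ) => e2 i
    rw [← Finset.mul_sum, Finset.sum_comm, Finset.sum_const, nsmul_eq_mul, Finset.card_univ,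
      Fintype.card_fin] at e3
    refine le_trans ?_ e3
    have e4 := Finset.sum_le_sum fun s (_ : s ∈ Finset.univ) => h1 j s
    rw [Finset.sum_const, nsmul_eq_mul, hcardk] at e4
    exact mul_le_mul_of_nonneg_left e4 (by linarith)
  have h4 : ∑ j ∈ Finset.range J, (q - 1) * (q ^ k * (m - (j : ℝ) ^ k)) ≤
      k * ((q - 1) * (∑ s, a 0 s - ∑ s, a J s) + J * (q ^ k * N)) := by
    refine (Finset.sum_le_sum fun j _ => h3 j).trans (le_of_eq ?_)
    rw [← Finset.mul_sum, Finset.sum_add_distrib, ← Finset.mul_sum,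
      Finset.sum_range_sub' fun j => ∑ s, a j s, Finset.sum_const, nsmul_eq_mul, Finset.card_range]
  have h5 : ∑ s, a 0 s ≤ q ^ k * N := by
    rw [← hcardk, ← nsmul_eq_mul, ← Finset.sum_const]
    refine Finset.sum_le_sum fun s _ => ?_
    exact haN 0 s
  have h6 : 0 ≤ ∑ s, a J s := Finset.sum_nonneg fun s _ => ha0 J s
  have h7 : (J : ℝ) * ((q - 1) * (q ^ k * (m - (J : ℝ) ^ k))) ≤
      ∑ j ∈ Finset.range J, (q - 1) * (q ^ k * (m - (j : ℝ) ^ k)) := by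
    rw [← Finset.card_range J, ← nsmul_eq_mul, ← Finset.sum_const, Finset.card_range]
    refine Finset.sum_le_sum fun j hj => ?_
    have : (j : ℝ) ≤ J := by exact_mod_cast (Finset.mem_range.1 hj).le
    have hq0 : 0 ≤ q - 1 := by linarith
    gcongr
  have hqk : 0 < q ^ k := by positivity
  have h8 : (q - 1) * (∑ s, a 0 s - ∑ s, a J s) ≤ (q - 1) * (q ^ k * N) :=
    mul_le_mul_of_nonneg_left (by linarith) (by linarith)
  have h9 : (k : ℝ) * ((q - 1) * (∑ s, a 0 s - ∑ s, a J s) + J * (q ^ k * N)) ≤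
      k * ((q - 1) * (q ^ k * N) + J * (q ^ k * N)) := by gcongr
  refine le_of_mul_le_mul_left ?_ hqk
  linarith

open Module in
theorem finrank_lower_bound_of_hyperplanes {F A : Type*} [Field F] [Fintype F] [CommRing A]
    [Algebra F A] [FiniteDimensional F A] {k : ℕ} (l : A) (y : Fin k → A)
    (hgen : Algebra.adjoin F (insert l (Set.range y)) = ⊤) (m : ℝ)
    (hm : ∀ s : Fin k → F,
      m + finrank F (principalSubspace F (l + ∑ i, s i • y i)) ≤ finrank F A) (J : ℕ) :
    ((Fintype.card F : ℝ) - 1) * J * (m - (J : ℝ) ^ k) ≤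
      k * (((Fintype.card F : ℝ) - 1) + J) * finrank F A := by
  classical
  set q : ℝ := (Fintype.card F : ℝ) with hq
  set N : ℝ := (finrank F A : ℝ) with hN
  set ls : (Fin k → F) → A := fun s => l + ∑ i, s i • y i with hls
  set a : ℕ → (Fin k → F) → ℝ := fun j s => finrank F (principalSubspace F (ls s ^ j)) with ha
  set R : Fin k → ℕ → (Fin k → F) → ℝ := fun i j s =>
    (finrank F ↥(principalSubspace F (ls s) ⊔ principalSubspace F (y i ^ j)) : ℝ) -
      finrank F (principalSubspace F (ls s)) with hR
  have hcard : ((Finset.univ.erase (0 : F)).card : ℝ) = q - 1 := by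
    rw [Finset.card_erase_of_mem (Finset.mem_univ _), Finset.card_univ,
      Nat.cast_sub Fintype.card_pos]
    simp [hq]
  have h1 : ∀ (j : ℕ) s, m - (j : ℝ) ^ k ≤ ∑ i, R i j s := by
    intro j s
    have hgen' : Algebra.adjoin F (insert (ls s) (Set.range y)) = ⊤ := by
      rw [eq_top_iff, ← hgen, Algebra.adjoin_le_iff]
      have hy : ∀ i, y i ∈ Algebra.adjoin F (insert (ls s) (Set.range y)) := fun i =>
        Algebra.subset_adjoin (Set.mem_insert_of_mem _ ⟨i, rfl⟩)
      rintro x (rfl | ⟨i, rfl⟩)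
      · have : x = ls s - ∑ i, s i • y i := by simp [hls]
        rw [this]
        exact sub_mem (Algebra.subset_adjoin (Set.mem_insert _ _))
          (sum_mem fun i _ => Subalgebra.smul_mem _ (hy i) _)
      · exact hy i
    have e1 : N ≤ (j : ℝ) ^ k + finrank F ↥(principalSubspace F (ls s) ⊔
        Finset.univ.sup fun i => principalSubspace F (y i ^ j)) := by
      rw [hN]
      exact_mod_cast finrank_le_pow_add_finrank_sup (ls s) y hgen' j
    have e2 := finrank_sup_finset_sup_le (principalSubspace F (ls s))
      (fun i => principalSubspace F (y i ^ j)) Finset.univ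
    have e3 := hm s
    simp only [hR]
    linarith
  have hshift : ∀ i s (u : F), ls (s + (Pi.single i u : Fin k → F)) = ls s + u • y i := by
    intro i s u
    simp [hls, add_smul, Finset.sum_add_distrib, Pi.single_apply, ite_smul, add_assoc]
  refine averaging_bound a R m N J (fun j s => Nat.cast_nonneg _)
    (fun j s => Nat.cast_le.2 (Submodule.finrank_le _)) h1 ?_
  · intro i j s
    have e1 : ∀ u ∈ Finset.univ.erase (0 : F), R i j (s + (Pi.single i u : Fin k → F)) ≤
        a j s - finrank F (principalSubspace F ((ls s + u • y i) * ls s ^ j)) := by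
      intro u hu
      have := finrank_sup_sub_le (ls s) (y i) (Finset.ne_of_mem_erase hu) j
      have h' : (finrank F ↥(principalSubspace F (ls s + u • y i) ⊔
          principalSubspace F (y i ^ j)) : ℝ) +
          finrank F (principalSubspace F ((ls s + u • y i) * ls s ^ j)) ≤
        finrank F (principalSubspace F (ls s + u • y i)) +
          finrank F (principalSubspace F (ls s ^ j)) := by exact_mod_cast this
      simp only [hR, ha]
      rw [hshift]
      linarith
    have e2 := card_mul_finrank_range_le (LinearMap.mulLeft F (ls s ^ (j + 1)))
      (LinearMap.mulLeft F (y i * ls s ^ j))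
    have e3 : ∀ u : F, LinearMap.mulLeft F (ls s ^ (j + 1)) +
        u • LinearMap.mulLeft F (y i * ls s ^ j) =
        LinearMap.mulLeft F ((ls s + u • y i) * ls s ^ j) := by
      intro u
      ext z
      rw [LinearMap.add_apply, LinearMap.smul_apply]
      simp only [LinearMap.mulLeft_apply, Algebra.smul_def]
      ring
    have e3' : ∀ u ∈ Finset.univ.erase (0 : F), finrank F (LinearMap.range
        (LinearMap.mulLeft F (ls s ^ (j + 1)) + u • LinearMap.mulLeft F (y i * ls s ^ j))) =
        finrank F (LinearMap.range (LinearMap.mulLeft F ((ls s + u • y i) * ls s ^ j))) :=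
      fun u _ => by rw [e3 u]
    rw [Finset.sum_congr rfl e3'] at e2
    have e4 : finrank F (LinearMap.range (LinearMap.mulLeft F (ls s ^ (j + 1)))) ≤ finrank F A :=
      Submodule.finrank_le _
    have e5 : ∑ _u ∈ Finset.univ.erase (0 : F), a (j + 1) s ≤
        ∑ u ∈ Finset.univ.erase (0 : F),
          (finrank F (principalSubspace F ((ls s + u • y i) * ls s ^ j)) : ℝ) + N := by
      simp only [ha, hN, principalSubspace]
      exact_mod_cast e2.trans (Nat.add_le_add_left e4 _)
    have e6 := (Finset.sum_le_sum e1).trans_eq (Finset.sum_sub_distrib _ _)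
    rw [Finset.sum_const, nsmul_eq_mul, hcard] at e5 e6
    linarith

open Module in
theorem exists_linearForms_of_codim_succ {F V A : Type*} [Field F] [AddCommGroup V] [Module F V]
    [FiniteDimensional F V] [CommRing A] [Algebra F A] [FiniteDimensional F A] (φ : V →ₗ[F] A)
    (hφ : Algebra.adjoin F (Set.range φ) = ⊤) {k : ℕ} (m : ℝ)
    (hm : ∀ L : Submodule F V, finrank F L + k = finrank F V →
      m ≤ finrank F (A ⧸ Ideal.span (φ '' L)))
    (L : Submodule F V) (hL : finrank F L + (k + 1) = finrank F V) :
    ∃ (l : A ⧸ Ideal.span (φ '' L)) (y : Fin k → A ⧸ Ideal.span (φ '' L)),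
      Algebra.adjoin F (insert l (Set.range y)) = ⊤ ∧
      ∀ s : Fin k → F, m + finrank F (principalSubspace F (l + ∑ i, s i • y i)) ≤
        finrank F (A ⧸ Ideal.span (φ '' L)) := by
  set K := Ideal.span (φ '' L) with hK
  have hdim : finrank F (V ⧸ L) = k + 1 := by
    have := L.finrank_quotient_add_finrank
    omega
  set b := finBasisOfFinrankEq F (V ⧸ L) hdim with hb
  choose v hv using fun i => L.mkQ_surjective (b i)
  set ψ : V →ₗ[F] A ⧸ K := (Ideal.Quotient.mkₐ F K).toLinearMap ∘ₗ φ with hψ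
  have hψL : ∀ x ∈ L, ψ x = 0 := fun x hx =>
    Ideal.Quotient.eq_zero_iff_mem.2 (Ideal.subset_span ⟨x, hx, rfl⟩)
  refine ⟨ψ (v 0), fun i => ψ (v i.succ), ?_, fun s => ?_⟩
  · have hmem : ∀ i, ψ (v i) ∈ Algebra.adjoin F
        (insert (ψ (v 0)) (Set.range fun i : Fin k => ψ (v i.succ))) := by
      intro i
      refine Algebra.subset_adjoin ?_
      induction i using Fin.cases with
      | zero => exact Set.mem_insert _ _
      | succ i => exact Set.mem_insert_of_mem _ ⟨i, rfl⟩
    have htop : Algebra.adjoin F (Set.range ψ) = ⊤ := by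
      have : Set.range ψ = Ideal.Quotient.mkₐ F K '' Set.range φ := by
        rw [← Set.range_comp]; rfl
      rw [this, ← AlgHom.map_adjoin, hφ, Algebra.map_top, AlgHom.range_eq_top]
      exact Ideal.Quotient.mkₐ_surjective F K
    rw [eq_top_iff, ← htop, Algebra.adjoin_le_iff]
    rintro _ ⟨x, rfl⟩
    have hx : x - ∑ i, b.repr (L.mkQ x) i • v i ∈ L := by
      refine (Submodule.Quotient.mk_eq_zero L).1 ?_
      rw [← Submodule.mkQ_apply, map_sub, map_sum]
      simp only [map_smul, hv, b.sum_repr, sub_self]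
    have hx' := hψL _ hx
    rw [map_sub, sub_eq_zero, map_sum] at hx'
    rw [hx']
    refine sum_mem fun i _ => ?_
    rw [map_smul]
    exact Subalgebra.smul_mem _ (hmem i) _
  · set w : V := v 0 + ∑ i : Fin k, s i • v i.succ with hw
    have hwL : w ∉ L := by
      intro h
      rw [← Submodule.ker_mkQ L, LinearMap.mem_ker, hw, map_add, map_sum] at h
      simp only [map_smul, hv] at h
      have h2 := Fintype.linearIndependent_iff.1 b.linearIndependent (Fin.cons 1 s)
        (by simpa [Fin.sum_univ_succ] using h) 0
      simp at h2
    have hψw : ψ (v 0) + ∑ i : Fin k, s i • ψ (v i.succ) = ψ w := by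
      simp [hw]
    rw [hψw]
    have h1 := hm (L ⊔ Submodule.span F {w})
      (by rw [Submodule.finrank_sup_span_singleton hwL]; omega)
    set K' := Ideal.span (φ '' ↑(L ⊔ Submodule.span F {w})) with hK'
    have hKK : K ≤ K' := Ideal.span_mono (Set.image_mono (SetLike.coe_subset_coe.2 le_sup_left))
    set f : (A ⧸ K) →ₗ[F] (A ⧸ K') := (Ideal.Quotient.factorₐ F hKK).toLinearMap with hf
    have hfs : LinearMap.range f = ⊤ :=
      LinearMap.range_eq_top.2 (Ideal.Quotient.factor_surjective hKK)
    have hfw : f (ψ w) = 0 := by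
      change Ideal.Quotient.mk K' (φ w) = 0
      exact Ideal.Quotient.eq_zero_iff_mem.2 (Ideal.subset_span
        ⟨w, Submodule.mem_sup_right (Submodule.mem_span_singleton_self w), rfl⟩)
    have hP : principalSubspace F (ψ w) ≤ LinearMap.ker f := by
      intro z hz
      obtain ⟨c, rfl⟩ := mem_principalSubspace.1 hz
      rw [LinearMap.mem_ker]
      have : f (ψ w * c) = f (ψ w) * f c := map_mul (Ideal.Quotient.factorₐ F hKK) _ _
      rw [this, hfw, zero_mul]
    have h2 := LinearMap.finrank_range_add_finrank_ker f
    rw [hfs, finrank_top] at h2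
    have h3 := Submodule.finrank_mono hP
    have h4 : (finrank F (A ⧸ K') : ℝ) + finrank F (principalSubspace F (ψ w)) ≤
        finrank F (A ⧸ K) := by exact_mod_cast (by omega)
    linarith

open Module in
theorem finrank_quotient_lower_bound_step {F V A : Type*} [Field F] [Fintype F] [AddCommGroup V]
    [Module F V] [FiniteDimensional F V] [CommRing A] [Algebra F A] [FiniteDimensional F A]
    (φ : V →ₗ[F] A) (hφ : Algebra.adjoin F (Set.range φ) = ⊤) {k : ℕ} (hk : 1 ≤ k) (r : ℝ)
    (hr : 0 < r) (hrq : r ≤ Fintype.card F)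
    (hm : ∀ L : Submodule F V, finrank F L + k = finrank F V →
      r ^ k ≤ finrank F (A ⧸ Ideal.span (φ '' L)))
    (L : Submodule F V) (hL : finrank F L + (k + 1) = finrank F V) :
    (1 / 2 ^ (k + 4)) * r ^ (k + 1) ≤ finrank F (A ⧸ Ideal.span (φ '' L)) := by
  obtain ⟨l, y, hgen, hy⟩ := exists_linearForms_of_codim_succ φ hφ (r ^ k) hm L hL
  set N : ℝ := (finrank F (A ⧸ Ideal.span (φ '' L)) : ℝ) with hN
  rw [one_div, inv_mul_le_iff₀ (by positivity)]
  by_cases hr2 : r < 2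
  · have hN1 : 1 ≤ N := by
      have h0 : 0 < N := by
        have h1 := hy 0
        have h2 : 0 < r ^ k := by positivity
        have h3 : (0 : ℝ) ≤ finrank F (principalSubspace F (l + ∑ i, (0 : Fin k → F) i • y i)) :=
          Nat.cast_nonneg _
        linarith
      rw [hN] at h0 ⊢
      exact_mod_cast (Nat.cast_pos.1 h0 : 0 < finrank F (A ⧸ Ideal.span (φ '' L)))
    calc r ^ (k + 1) ≤ 2 ^ (k + 1) := by gcongr
      _ ≤ 2 ^ (k + 4) * 1 := by
        rw [mul_one]; exact pow_le_pow_right₀ (by norm_num) (by omega)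
      _ ≤ 2 ^ (k + 4) * N := by gcongr
  · have hr2 : 2 ≤ r := not_lt.1 hr2
    set J := ⌊r / 2⌋₊ with hJ
    have hJ1 : (J : ℝ) ≤ r / 2 := Nat.floor_le (by positivity)
    have hJ2 : r / 4 ≤ J := by
      have h1 : r / 2 < J + 1 := Nat.lt_floor_add_one _
      have h2 : (1 : ℝ) ≤ J := by
        exact_mod_cast Nat.le_floor (by push_cast; linarith)
      linarith
    have hb := finrank_lower_bound_of_hyperplanes l y hgen (r ^ k) hy J
    set q : ℝ := (Fintype.card F : ℝ) with hq
    rw [← hN] at hb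
    have hJq : (J : ℝ) ≤ q - 1 := by linarith
    have hq1 : 0 < q - 1 := by linarith
    have hN0 : 0 ≤ N := Nat.cast_nonneg _
    have hJk : (J : ℝ) ^ k ≤ r ^ k / 2 := by
      calc (J : ℝ) ^ k ≤ (r / 2) ^ k := by gcongr
        _ = r ^ k / 2 ^ k := div_pow _ _ _
        _ ≤ r ^ k / 2 ^ 1 := by
          gcongr
          norm_num
        _ = r ^ k / 2 := by rw [pow_one]
    have h1 : (q - 1) * (J * (r ^ k - (J : ℝ) ^ k)) ≤ (q - 1) * (2 * k * N) := by
      have : (k : ℝ) * ((q - 1) + J) * N ≤ k * ((q - 1) + (q - 1)) * N := by gcongr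
      linarith
    have h2 := le_of_mul_le_mul_left h1 hq1
    have h3 : r / 4 * (r ^ k / 2) ≤ J * (r ^ k - (J : ℝ) ^ k) := by
      apply mul_le_mul hJ2 (by linarith) (by positivity) (Nat.cast_nonneg _)
    have hk2 : (k : ℝ) ≤ 2 ^ k := by exact_mod_cast Nat.lt_two_pow_self.le
    have h4 : (k : ℝ) * N ≤ 2 ^ k * N := by gcongr
    rw [pow_succ, pow_add]
    linarith

open Module in
theorem exists_finrank_quotient_lower_bound {k : ℕ} (hk : 1 ≤ k) {n : ℕ} (hkn : k ≤ n) :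
    ∃ D : ℝ, 0 < D ∧ D ≤ 1 ∧
      ∀ {F V A : Type} [Field F] [Fintype F] [AddCommGroup V] [Module F V]
        [FiniteDimensional F V] [CommRing A] [Algebra F A] [FiniteDimensional F A]
        (φ : V →ₗ[F] A), Algebra.adjoin F (Set.range φ) = ⊤ →
        ∀ r : ℝ, 0 < r → r ≤ Fintype.card F →
        (∀ L : Submodule F V, finrank F L + k = finrank F V →
          r ^ k ≤ finrank F (A ⧸ Ideal.span (φ '' L))) →
        ∀ L : Submodule F V, finrank F L + n = finrank F V →
          (D * r) ^ n ≤ finrank F (A ⧸ Ideal.span (φ '' L)) := by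
  induction n, hkn using Nat.le_induction with
  | base => exact ⟨1, one_pos, le_rfl, fun φ _ r _ _ h L hL => by simpa using h L hL⟩
  | succ j hkj ih =>
    obtain ⟨D, hD0, hD1, hD⟩ := ih
    set c : ℝ := 1 / 2 ^ (j + 4) with hc
    have hc0 : 0 < c := by positivity
    have hc1 : c ≤ 1 := by
      rw [hc, div_le_one (by positivity)]
      exact one_le_pow₀ (by norm_num)
    refine ⟨c * D, by positivity, mul_le_one₀ hc1 hD0.le hD1, ?_⟩
    intro F V A _ _ _ _ _ _ _ _ φ hφ r hr hrq h L hL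
    have h1 := finrank_quotient_lower_bound_step φ hφ (hk.trans hkj) (D * r) (by positivity)
      ((mul_le_of_le_one_left hr.le hD1).trans hrq) (hD φ hφ r hr hrq h) L hL
    refine le_trans ?_ h1
    rw [mul_assoc, mul_pow]
    have : c ^ (j + 1) ≤ c := pow_le_of_le_one hc0.le hc1 (by omega)
    gcongr

section leadingForm

variable {F σ : Type*} [Field F]

theorem homogeneousComponent_succ_X_mul (i : σ) (d : ℕ) (g : MvPolynomial σ F) :
    homogeneousComponent (d + 1) (X i * g) = X i * homogeneousComponent d g := by
  classical
  ext m
  rw [coeff_homogeneousComponent, coeff_X_mul', coeff_X_mul', coeff_homogeneousComponent]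
  by_cases hi : i ∈ m.support
  · have hm : m = m - Finsupp.single i 1 + Finsupp.single i 1 := by
      rw [tsub_add_cancel_of_le]
      rw [Finsupp.single_le_iff]
      exact Nat.one_le_iff_ne_zero.2 (Finsupp.mem_support_iff.1 hi)
    have hdeg : m.degree = (m - Finsupp.single i 1).degree + 1 := by
      conv_lhs => rw [hm]
      simp
    rw [if_pos hi, if_pos hi, hdeg]
    simp only [add_left_inj]
  · simp [hi]

theorem homogeneousComponent_zero_X_mul (i : σ) (g : MvPolynomial σ F) :
    homogeneousComponent 0 (X i * g) = 0 := by
  classical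
  rw [homogeneousComponent_zero, coeff_X_mul']
  simp

/-- The ideal generated by the top-degree forms of the elements of `I`: a polynomial belongs to it
if each of its homogeneous components is the degree `d` component of an element of `I` of degree
at most `d`. -/
noncomputable def leadingFormIdeal (I : Ideal (MvPolynomial σ F)) : Ideal (MvPolynomial σ F) where
  carrier := {g | ∀ d, ∃ f ∈ I, (∀ m : σ →₀ ℕ, d + 1 ≤ m.degree → coeff m f = 0) ∧
    homogeneousComponent d f = homogeneousComponent d g}
  zero_mem' d := ⟨0, I.zero_mem, by simp, rfl⟩
  add_mem' := by
    intro g g' hg hg' d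
    obtain ⟨f, hf, hfd, hfg⟩ := hg d
    obtain ⟨f', hf', hfd', hfg'⟩ := hg' d
    exact ⟨f + f', add_mem hf hf', fun m hm => by rw [coeff_add, hfd m hm, hfd' m hm, add_zero],
      by rw [map_add, map_add, hfg, hfg']⟩
  smul_mem' := by
    intro a
    induction a using MvPolynomial.induction_on with
    | C r =>
      intro g hg d
      obtain ⟨f, hf, hfd, hfg⟩ := hg d
      exact ⟨C r * f, I.mul_mem_left _ hf, fun m hm => by rw [coeff_C_mul, hfd m hm, mul_zero],
        by rw [smul_eq_mul, homogeneousComponent_C_mul, homogeneousComponent_C_mul, hfg]⟩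
    | add p p' hp hp' =>
      intro g hg d
      obtain ⟨f, hf, hfd, hfg⟩ := hp hg d
      obtain ⟨f', hf', hfd', hfg'⟩ := hp' hg d
      exact ⟨f + f', add_mem hf hf', fun m hm => by rw [coeff_add, hfd m hm, hfd' m hm, add_zero],
        by rw [add_smul, map_add, map_add, hfg, hfg']⟩
    | mul_X p i hp =>
      intro g hg
      rw [smul_eq_mul, mul_assoc]
      refine hp (x := X i * g) ?_
      intro d
      cases d with
      | zero =>
        exact ⟨0, I.zero_mem, by simp, by rw [homogeneousComponent_zero_X_mul, map_zero]⟩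
      | succ d =>
        obtain ⟨f, hf, hfd, hfg⟩ := hg d
        refine ⟨X i * f, I.mul_mem_left _ hf, fun m hm => ?_,
          by rw [homogeneousComponent_succ_X_mul, homogeneousComponent_succ_X_mul, hfg]⟩
        classical
        rw [coeff_X_mul']
        split_ifs with hi
        · refine hfd _ ?_
          have hm' : m - Finsupp.single i 1 + Finsupp.single i 1 = m := by
            rw [tsub_add_cancel_of_le]
            rw [Finsupp.single_le_iff]
            exact Nat.one_le_iff_ne_zero.2 (Finsupp.mem_support_iff.1 hi)
          have := congrArg Finsupp.degree hm'
          simp only [map_add, Finsupp.degree_single] at this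
          omega
        · rfl

theorem mem_leadingFormIdeal {I : Ideal (MvPolynomial σ F)} {g : MvPolynomial σ F} :
    g ∈ leadingFormIdeal I ↔ ∀ d, ∃ f ∈ I,
      (∀ m : σ →₀ ℕ, d + 1 ≤ m.degree → coeff m f = 0) ∧
        homogeneousComponent d f = homogeneousComponent d g := Iff.rfl

theorem leadingFormIdeal_mono {I J : Ideal (MvPolynomial σ F)} (h : I ≤ J) :
    leadingFormIdeal I ≤ leadingFormIdeal J := by
  intro g hg d
  obtain ⟨f, hf, hfd⟩ := hg d
  exact ⟨f, h hf, hfd⟩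

theorem homogeneousComponent_mem_leadingFormIdeal {I : Ideal (MvPolynomial σ F)}
    {f : MvPolynomial σ F} (hf : f ∈ I) {d : ℕ}
    (hd : ∀ m : σ →₀ ℕ, d + 1 ≤ m.degree → coeff m f = 0) :
    homogeneousComponent d f ∈ leadingFormIdeal I := by
  intro e
  rw [homogeneousComponent_of_mem (homogeneousComponent_mem d f)]
  split_ifs with h
  · subst h
    exact ⟨f, hf, hd, rfl⟩
  · exact ⟨0, I.zero_mem, by simp, by simp⟩

theorem coeff_eq_zero_of_homogeneousComponent_eq_zero {f : MvPolynomial σ F} {d : ℕ}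
    (hd : ∀ m : σ →₀ ℕ, d + 1 ≤ m.degree → coeff m f = 0) (h : homogeneousComponent d f = 0)
    (m : σ →₀ ℕ) (hm : d ≤ m.degree) : coeff m f = 0 := by
  rcases hm.eq_or_lt with rfl | hm
  · have := congrArg (coeff m) h
    simpa [coeff_homogeneousComponent] using this
  · exact hd m hm

theorem isCompl_of_isCompl_leadingFormIdeal {I : Ideal (MvPolynomial σ F)}
    {T : Submodule F (MvPolynomial σ F)}
    (hT : ∀ d, ∀ f ∈ T, homogeneousComponent d f ∈ T)
    (h : IsCompl ((leadingFormIdeal I).restrictScalars F) T) :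
    IsCompl (I.restrictScalars F) T := by
  have hbound : ∀ f : MvPolynomial σ F, ∃ d, ∀ m : σ →₀ ℕ, d ≤ m.degree → coeff m f = 0 :=
    fun f => ⟨f.totalDegree + 1, fun m hm => coeff_eq_zero_of_totalDegree_lt hm⟩
  constructor
  · have h1 := Submodule.disjoint_def.1 h.disjoint
    rw [Submodule.disjoint_def]
    intro f hfI hfT
    obtain ⟨d, hd⟩ := hbound f
    induction d with
    | zero => ext m; exact hd m (Nat.zero_le _)
    | succ d ih =>
      exact ih (coeff_eq_zero_of_homogeneousComponent_eq_zero hd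
        (h1 _ (homogeneousComponent_mem_leadingFormIdeal hfI hd) (hT d f hfT)))
  · rw [codisjoint_iff, eq_top_iff]
    intro f _
    obtain ⟨d, hd⟩ := hbound f
    induction d generalizing f with
    | zero =>
      have : f = 0 := by ext m; exact hd m (Nat.zero_le _)
      rw [this]
      exact zero_mem _
    | succ d ih =>
      have hmem : homogeneousComponent d f ∈ (leadingFormIdeal I).restrictScalars F ⊔ T := by
        rw [h.sup_eq_top]; trivial
      obtain ⟨g, hg, t, ht, hgt⟩ := Submodule.mem_sup.1 hmem
      obtain ⟨f', hf', hfd', hfg'⟩ := mem_leadingFormIdeal.1 hg d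
      have hself : ∀ p : MvPolynomial σ F,
          homogeneousComponent d (homogeneousComponent d p) = homogeneousComponent d p :=
        fun p => homogeneousComponent_eq_self (homogeneousComponent_isHomogeneous d p)
      have key : f - f' - homogeneousComponent d t ∈ I.restrictScalars F ⊔ T := by
        refine ih Submodule.mem_top (coeff_eq_zero_of_homogeneousComponent_eq_zero (fun m hm => ?_) ?_)
        · rw [coeff_sub, coeff_sub, hd m hm, hfd' m hm, coeff_homogeneousComponent,
            if_neg (by omega)]
          simp
        · have := congrArg (homogeneousComponent d) hgt
          rw [hself, map_add] at this
          rw [map_sub, map_sub, hself, hfg', ← this]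
          ring
      have e : f = (f - f' - homogeneousComponent d t) + f' + homogeneousComponent d t := by ring
      rw [e]
      exact add_mem (add_mem key (Submodule.mem_sup_left hf'))
        (Submodule.mem_sup_right (hT d t ht))

theorem exists_isCompl_homogeneousComponent_mem (Q : Submodule F (MvPolynomial σ F)) :
    ∃ T : Submodule F (MvPolynomial σ F),
      (∀ d, ∀ f ∈ T, homogeneousComponent d f ∈ T) ∧ IsCompl Q T := by
  obtain ⟨κ, a, -, hspan, hli⟩ :=
    exists_linearIndependent' F fun m : σ →₀ ℕ => Q.mkQ (monomial m (1 : F))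
  set v : κ → MvPolynomial σ F := fun i => monomial (a i) 1 with hv
  refine ⟨Submodule.span F (Set.range v), fun d => ?_, ?_, ?_⟩
  · have : Submodule.span F (Set.range v) ≤
        (Submodule.span F (Set.range v)).comap (homogeneousComponent d) := by
      rw [Submodule.span_le]
      rintro _ ⟨i, rfl⟩
      change homogeneousComponent d (v i) ∈ Submodule.span F (Set.range v)
      rw [homogeneousComponent_of_mem (isHomogeneous_monomial (1 : F) rfl)]
      split_ifs
      · exact Submodule.subset_span ⟨i, rfl⟩
      · exact zero_mem _
    exact fun f hf => this hf
  · rw [Submodule.disjoint_def]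
    intro x hxQ hx
    obtain ⟨c, rfl⟩ := Finsupp.mem_span_range_iff_exists_finsupp.1 hx
    have h0 : Finsupp.linearCombination F ((fun m : σ →₀ ℕ => Q.mkQ (monomial m (1 : F))) ∘ a) c
        = 0 := by
      rw [← (Submodule.Quotient.mk_eq_zero Q).2 hxQ, ← Submodule.mkQ_apply,
        Finsupp.linearCombination_apply, Finsupp.sum, Finsupp.sum, map_sum]
      simp [hv]
    rw [linearIndependent_iff.1 hli c h0]
    simp
  · rw [codisjoint_iff, ← Submodule.map_mkQ_eq_top, Submodule.map_span, ← Set.range_comp]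
    have htop : Submodule.span F (Set.range fun m : σ →₀ ℕ => Q.mkQ (monomial m (1 : F))) = ⊤ := by
      rw [show (fun m : σ →₀ ℕ => Q.mkQ (monomial m (1 : F))) =
        Q.mkQ ∘ fun m => monomial m (1 : F) from rfl, Set.range_comp, ← Submodule.map_span,
        show (Set.range fun m : σ →₀ ℕ => monomial m (1 : F)) =
          Set.range (basisMonomials σ F) by simp, (basisMonomials σ F).span_eq,
        Submodule.map_top, Submodule.range_mkQ]
    exact hspan.trans htop

/-- Passing to the ideal of leading forms preserves the quotient, as a vector space. -/
theorem nonempty_quotient_leadingFormIdeal_equiv (I : Ideal (MvPolynomial σ F)) :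
    Nonempty ((MvPolynomial σ F ⧸ leadingFormIdeal I) ≃ₗ[F] (MvPolynomial σ F ⧸ I)) := by
  obtain ⟨T, hT, hc⟩ := exists_isCompl_homogeneousComponent_mem
    ((leadingFormIdeal I).restrictScalars F)
  exact ⟨(Submodule.Quotient.restrictScalarsEquiv F _).symm ≪≫ₗ
    Submodule.quotientEquivOfIsCompl _ _ hc ≪≫ₗ
    (Submodule.quotientEquivOfIsCompl _ _ (isCompl_of_isCompl_leadingFormIdeal hT hc)).symm ≪≫ₗ
    Submodule.Quotient.restrictScalarsEquiv F _⟩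

end leadingForm

section linearForm

open Module

/-- The linear polynomial of a linear functional on `Fⁿ`. -/
noncomputable def linearForm (F : Type) [Field F] (n : ℕ) :
    Dual F (Fin n → F) →ₗ[F] MvPolynomial (Fin n) F where
  toFun f := ∑ i, f (Pi.single i 1) • X i
  map_add' f g := by simp [add_smul, Finset.sum_add_distrib]
  map_smul' a f := by simp [mul_smul, Finset.smul_sum]

variable {F : Type} [Field F] {n : ℕ}

theorem linearForm_apply (f : Dual F (Fin n → F)) :
    linearForm F n f = ∑ i, f (Pi.single i 1) • X i := rfl

theorem eval_linearForm (f : Dual F (Fin n → F)) (x : Fin n → F) :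
    eval x (linearForm F n f) = f x := by
  rw [linearForm_apply, map_sum]
  conv_rhs => rw [pi_eq_sum_univ' x, map_sum]
  exact Finset.sum_congr rfl fun i _ => by
    rw [smul_eval, eval_X, map_smul, smul_eq_mul, mul_comm]

theorem linearForm_proj (i : Fin n) : linearForm F n (LinearMap.proj i) = X i := by
  rw [linearForm_apply, Finset.sum_eq_single i]
  · simp
  · intro j _ hj
    simp [hj.symm]
  · simp

theorem isHomogeneous_linearForm (f : Dual F (Fin n → F)) :
    (linearForm F n f).IsHomogeneous 1 :=
  IsHomogeneous.sum _ _ _ fun i _ => by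
    rw [smul_eq_C_mul]
    exact (isHomogeneous_X F i).C_mul _

theorem adjoin_range_mk_linearForm (Q : Ideal (MvPolynomial (Fin n) F)) :
    Algebra.adjoin F (Set.range ((Ideal.Quotient.mkₐ F Q).toLinearMap ∘ₗ linearForm F n)) = ⊤ := by
  rw [eq_top_iff, ← (AlgHom.range_eq_top _).2 (Ideal.Quotient.mkₐ_surjective F Q),
    ← Algebra.map_top, ← adjoin_range_X, AlgHom.map_adjoin]
  refine Algebra.adjoin_mono ?_
  rintro _ ⟨_, ⟨i, rfl⟩, rfl⟩
  exact ⟨LinearMap.proj i, by simp [linearForm_proj]⟩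

theorem linearForm_mem_leadingFormIdeal {I : Ideal (MvPolynomial (Fin n) F)}
    {W : Submodule F (Fin n → F)} {v : Fin n → F} {f : Dual F (Fin n → F)}
    (hf : ∀ w ∈ W, f w = 0) :
    linearForm F n f ∈ leadingFormIdeal (I + affineSubspaceIdeal F n {x | x - v ∈ W}) := by
  have hdeg : (linearForm F n f - C (f v)).totalDegree ≤ 1 :=
    (totalDegree_sub _ _).trans (max_le (isHomogeneous_linearForm f).totalDegree_le (by simp))
  have hmem : linearForm F n f - C (f v) ∈
      I + affineSubspaceIdeal F n {x | x - v ∈ W} := by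
    refine Ideal.mem_sup_right (Ideal.subset_span ⟨hdeg, fun x hx => ?_⟩)
    rw [map_sub, eval_linearForm, eval_C, ← map_sub]
    exact hf _ hx
  have := homogeneousComponent_mem_leadingFormIdeal hmem (d := 1)
    fun m hm => coeff_eq_zero_of_totalDegree_lt (lt_of_le_of_lt hdeg hm)
  rwa [map_sub, homogeneousComponent_eq_self (isHomogeneous_linearForm f),
    homogeneousComponent_eq_zero 1 (C (f v)) (by simp), sub_zero] at this

theorem finrank_quotient_le_finrank_quotient_span_linearForm {I J : Ideal (MvPolynomial (Fin n) F)}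
    [FiniteDimensional F (MvPolynomial (Fin n) F ⧸ I)] (hIJ : I ≤ J)
    {L : Set (Dual F (Fin n → F))} (hL : ∀ f ∈ L, linearForm F n f ∈ J) :
    finrank F (MvPolynomial (Fin n) F ⧸ J) ≤
      finrank F ((MvPolynomial (Fin n) F ⧸ I) ⧸
        Ideal.span (((Ideal.Quotient.mkₐ F I).toLinearMap ∘ₗ linearForm F n) '' L)) := by
  let g := Ideal.Quotient.factorₐ F hIJ
  have hg : ∀ a ∈ Ideal.span (((Ideal.Quotient.mkₐ F I).toLinearMap ∘ₗ linearForm F n) '' L),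
      g a = 0 := by
    intro a ha
    refine Submodule.span_le (p := RingHom.ker g).2 ?_ ha
    rintro _ ⟨f, hf, rfl⟩
    exact Ideal.Quotient.eq_zero_iff_mem.2 (hL f hf)
  refine LinearMap.finrank_le_finrank_of_surjective
    (f := (Ideal.Quotient.liftₐ _ g hg).toLinearMap) ?_
  exact Ideal.Quotient.lift_surjective_of_surjective _ hg (Ideal.Quotient.factor_surjective hIJ)

end linearForm

/-- **k-plane Furstenberg scheme bound over finite fields** (Theorem 1.5).
If the 0-dimensional subscheme `S` of `𝔸ⁿ/F_q` defined by `I` meets, for every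
`k`-dimensional direction `W`, some parallel `k`-plane `v + W` in degree at least
`q^c`, then `|S| > C·q^{cn/k}`. -/
theorem kplane_furstenberg_schemes (n k : ℕ) (hn : 1 ≤ n) (hk1 : 1 ≤ k) (hkn : k ≤ n) :
    ∃ C : ℝ, 0 < C ∧
      ∀ (c : ℝ), 0 ≤ c → c ≤ (k : ℝ) →
      ∀ (F : Type) [Field F] [Fintype F],
      ∀ I : Ideal (MvPolynomial (Fin n) F),
        FiniteDimensional F (MvPolynomial (Fin n) F ⧸ I) →
        (∀ W : Submodule F (Fin n → F), Module.finrank F W = k →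
          ∃ v : Fin n → F,
            (Fintype.card F : ℝ) ^ c ≤
              (Module.finrank F (MvPolynomial (Fin n) F ⧸
                (I + affineSubspaceIdeal F n {x | x - v ∈ W})) : ℝ)) →
        C * (Fintype.card F : ℝ) ^ (c * n / k) <
          (Module.finrank F (MvPolynomial (Fin n) F ⧸ I) : ℝ) := by
  obtain ⟨D, hD0, -, hD⟩ := exists_finrank_quotient_lower_bound hk1 hkn
  refine ⟨D ^ n / 2, by positivity, fun c hc0 hck F _ _ I hI h => ?_⟩
  obtain ⟨e⟩ := nonempty_quotient_leadingFormIdeal_equiv I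
  have : FiniteDimensional F (MvPolynomial (Fin n) F ⧸ leadingFormIdeal I) :=
    Module.Finite.equiv e.symm
  have hk0 : (0 : ℝ) < k := by exact_mod_cast hk1
  have hq1 : (1 : ℝ) ≤ Fintype.card F := by exact_mod_cast Fintype.card_pos
  have hq0 : (0 : ℝ) < Fintype.card F := by linarith
  have hr0 : 0 < (Fintype.card F : ℝ) ^ (c / k) := Real.rpow_pos_of_pos hq0 _
  have hrq : (Fintype.card F : ℝ) ^ (c / k) ≤ Fintype.card F :=
    (Real.rpow_le_rpow_of_exponent_le hq1 ((div_le_one hk0).2 hck)).trans_eq (Real.rpow_one _)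
  have hrk : ((Fintype.card F : ℝ) ^ (c / k)) ^ k = (Fintype.card F : ℝ) ^ c := by
    rw [← Real.rpow_natCast, ← Real.rpow_mul hq0.le, div_mul_cancel₀ _ hk0.ne']
  have hrn : ((Fintype.card F : ℝ) ^ (c / k)) ^ n = (Fintype.card F : ℝ) ^ (c * n / k) := by
    rw [← Real.rpow_natCast, ← Real.rpow_mul hq0.le, div_mul_eq_mul_div]
  have hdim : Module.finrank F (Module.Dual F (Fin n → F)) = n := by
    rw [Subspace.dual_finrank_eq, Module.finrank_fin_fun]
  have key := hD ((Ideal.Quotient.mkₐ F (leadingFormIdeal I)).toLinearMap ∘ₗ linearForm F n)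
    (adjoin_range_mk_linearForm _) _ hr0 hrq (fun L hL => ?_) ⊥ (by simp)
  · have hle : Module.finrank F ((MvPolynomial (Fin n) F ⧸ leadingFormIdeal I) ⧸
        Ideal.span (((Ideal.Quotient.mkₐ F (leadingFormIdeal I)).toLinearMap ∘ₗ linearForm F n) ''
          (⊥ : Submodule F (Module.Dual F (Fin n → F))))) ≤
        Module.finrank F (MvPolynomial (Fin n) F ⧸ I) := by
      rw [← e.finrank_eq]
      exact LinearMap.finrank_le_finrank_of_surjective
        (f := (Ideal.Quotient.mkₐ F _).toLinearMap) (Ideal.Quotient.mkₐ_surjective F _)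
    rw [mul_pow, hrn] at key
    have hpos : 0 < D ^ n * (Fintype.card F : ℝ) ^ (c * n / k) :=
      mul_pos (pow_pos hD0 n) (Real.rpow_pos_of_pos hq0 _)
    have hle' := key.trans (Nat.cast_le.2 hle)
    linarith
  · obtain ⟨v, hv⟩ := h L.dualCoannihilator (by
      have := Subspace.finrank_add_finrank_dualCoannihilator_eq L
      rw [Module.finrank_fin_fun] at this
      omega)
    obtain ⟨e'⟩ := nonempty_quotient_leadingFormIdeal_equiv
      (I + affineSubspaceIdeal F n {x | x - v ∈ L.dualCoannihilator})
    rw [hrk]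
    refine hv.trans ?_
    rw [← e'.finrank_eq]
    exact_mod_cast finrank_quotient_le_finrank_quotient_span_linearForm
      (leadingFormIdeal_mono le_sup_left)
      fun f hf => linearForm_mem_leadingFormIdeal
        fun w hw => (Submodule.mem_dualCoannihilator w).1 hw f hf
end

section
/- Fix an integer n ≥ 2. There is a constant C > 0, depending only on n, with the following property: for every real number c ∈ [0, n−1], every finite field F with q elements, and every homogeneous ideal I ⊆ F[x₁,…,xₙ] such that N := dim_F F[x₁,…,xₙ]/I is finite, if dim_F F[x₁,…,xₙ]/(I + (ℓ)) ≥ q^c for every nonzero linear form ℓ = a₁x₁ + ⋯ + aₙxₙ (so every hyperplane through the origin is q^c-rich), then N ≥ C · q^{cn/(n−1)}. -/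
open MvPolynomial

/-- An ideal of the polynomial ring is homogeneous (with respect to the standard
grading) if it contains all homogeneous components of each of its elements. -/
def IsHomogeneousIdeal {F : Type} [Field F] {n : ℕ}
    (I : Ideal (MvPolynomial (Fin n) F)) : Prop :=
  ∀ f ∈ I, ∀ d : ℕ, MvPolynomial.homogeneousComponent d f ∈ I

namespace HyperplaneFurstenberg

open Module

variable {F : Type} [Field F] {n : ℕ}

instance finiteDimensional_homogeneousSubmodule (d : ℕ) :
    FiniteDimensional F (homogeneousSubmodule (Fin n) F d) :=
  Module.Finite.iff_fg.mpr (homogeneousSubmodule_fg (σ := Fin n) (R := F) d)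

/-- The linear form with a given vector of coefficients. -/
noncomputable def linearForm : (Fin n → F) →ₗ[F] MvPolynomial (Fin n) F :=
  Fintype.linearCombination F X

lemma linearForm_apply (a : Fin n → F) :
    linearForm a = ∑ i, C (a i) * (X i : MvPolynomial (Fin n) F) := by
  simp [linearForm, Fintype.linearCombination_apply, smul_eq_C_mul]

lemma linearForm_ne_zero {a : Fin n → F} (ha : a ≠ 0) : linearForm a ≠ 0 := by
  contrapose! ha
  funext i
  have h := congrArg (coeff (Finsupp.single i 1)) ha
  simpa [linearForm_apply, coeff_sum, coeff_C_mul, coeff_X, Finsupp.single_left_inj] using h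

lemma isHomogeneous_linearForm (a : Fin n → F) : (linearForm a).IsHomogeneous 1 := by
  rw [linearForm_apply]
  refine IsHomogeneous.sum _ _ _ fun i _ => ?_
  simpa using (isHomogeneous_C (Fin n) (a i)).mul (isHomogeneous_X F i)

/-- Codimension of `W` in the space of forms of degree `d`, for `W` contained in that space. -/
noncomputable def codim (d : ℕ) (W : Submodule F (MvPolynomial (Fin n) F)) : ℝ :=
  (finrank F (homogeneousSubmodule (Fin n) F d) : ℝ) - finrank F W

/-- The sum of `W` and the multiples of `p` by forms of degree `d`. -/
noncomputable def addMul (p : MvPolynomial (Fin n) F) (d : ℕ)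
    (W : Submodule F (MvPolynomial (Fin n) F)) : Submodule F (MvPolynomial (Fin n) F) :=
  W ⊔ (homogeneousSubmodule (Fin n) F d).map (LinearMap.mulLeft F p)

/-- The forms of degree `d` whose product with `p` lies in `W`. -/
noncomputable def colon (p : MvPolynomial (Fin n) F) (d : ℕ)
    (W : Submodule F (MvPolynomial (Fin n) F)) : Submodule F (MvPolynomial (Fin n) F) :=
  homogeneousSubmodule (Fin n) F d ⊓ W.comap (LinearMap.mulLeft F p)

lemma mul_mem_addMul {p f : MvPolynomial (Fin n) F} {d : ℕ} (hf : f.IsHomogeneous d)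
    (W : Submodule F (MvPolynomial (Fin n) F)) : p * f ∈ addMul p d W :=
  Submodule.mem_sup_right ⟨f, hf, rfl⟩

lemma le_addMul (p : MvPolynomial (Fin n) F) (d : ℕ)
    (W : Submodule F (MvPolynomial (Fin n) F)) : W ≤ addMul p d W := le_sup_left

lemma addMul_le {p : MvPolynomial (Fin n) F} {d : ℕ}
    {W U : Submodule F (MvPolynomial (Fin n) F)} :
    addMul p d W ≤ U ↔ W ≤ U ∧ ∀ f : MvPolynomial (Fin n) F, f.IsHomogeneous d → p * f ∈ U := by
  rw [addMul, sup_le_iff, Submodule.map_le_iff_le_comap]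
  rfl

lemma mem_colon {p f : MvPolynomial (Fin n) F} {d : ℕ}
    {W : Submodule F (MvPolynomial (Fin n) F)} :
    f ∈ colon p d W ↔ f.IsHomogeneous d ∧ p * f ∈ W := Iff.rfl

lemma isHomogeneous_linearForm_mul (a : Fin n → F) {d : ℕ} {f : MvPolynomial (Fin n) F}
    (hf : f.IsHomogeneous d) : (linearForm a * f).IsHomogeneous (d + 1) := by
  simpa [add_comm] using (isHomogeneous_linearForm a).mul hf

lemma addMul_linearForm_le (a : Fin n → F) {d : ℕ} {W : Submodule F (MvPolynomial (Fin n) F)}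
    (hW : W ≤ homogeneousSubmodule (Fin n) F (d + 1)) :
    addMul (linearForm a) d W ≤ homogeneousSubmodule (Fin n) F (d + 1) :=
  addMul_le.mpr ⟨hW, fun _ hf => isHomogeneous_linearForm_mul a hf⟩

lemma codim_le_codim {d e : ℕ} {W U : Submodule F (MvPolynomial (Fin n) F)} (h : W ≤ U)
    (hU : U ≤ homogeneousSubmodule (Fin n) F e) : codim d U ≤ codim d W := by
  have : FiniteDimensional F U := Submodule.finiteDimensional_of_le hU
  have := Submodule.finrank_mono h
  simp only [codim]
  gcongr

lemma codim_nonneg {d : ℕ} {W : Submodule F (MvPolynomial (Fin n) F)}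
    (h : W ≤ homogeneousSubmodule (Fin n) F d) : 0 ≤ codim d W := by
  simpa [codim] using Submodule.finrank_mono h

lemma codim_addMul_add_codim_colon {p : MvPolynomial (Fin n) F} (hp : p ≠ 0) {d e : ℕ}
    {W : Submodule F (MvPolynomial (Fin n) F)} (hW : W ≤ homogeneousSubmodule (Fin n) F e) :
    codim e (addMul p d W) + codim d (colon p d W) = codim e W := by
  have hinj : Function.Injective (LinearMap.mulLeft F p) := mul_right_injective₀ hp
  have hfin (U : Submodule F (MvPolynomial (Fin n) F)) :
      finrank F (U.map (LinearMap.mulLeft F p)) = finrank F U :=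
    (Submodule.equivMapOfInjective _ hinj U).finrank_eq.symm
  have : FiniteDimensional F W := Submodule.finiteDimensional_of_le hW
  have h₁ := Submodule.finrank_sup_add_finrank_inf_eq W
    ((homogeneousSubmodule (Fin n) F d).map (LinearMap.mulLeft F p))
  have h₂ : W ⊓ (homogeneousSubmodule (Fin n) F d).map (LinearMap.mulLeft F p) =
      (colon p d W).map (LinearMap.mulLeft F p) := by
    ext f
    constructor
    · rintro ⟨hf, g, hg, rfl⟩
      exact ⟨g, ⟨hg, hf⟩, rfl⟩
    · rintro ⟨g, ⟨hg, hf⟩, rfl⟩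
      exact ⟨hf, g, hg, rfl⟩
  rw [h₂, hfin, hfin] at h₁
  have h₃ : finrank F (addMul p d W) + finrank F (colon p d W) =
      finrank F W + finrank F (homogeneousSubmodule (Fin n) F d) := h₁
  have h₄ := congrArg (Nat.cast (R := ℝ)) h₃
  push_cast at h₄
  simp only [codim]
  linarith

lemma addMul_colon_le_colon_addMul (a b : Fin n → F) (d : ℕ)
    (W : Submodule F (MvPolynomial (Fin n) F)) :
    addMul (linearForm b) d (colon (linearForm a) (d + 1) W) ≤
      colon (linearForm a) (d + 1) (addMul (linearForm b) (d + 1) W) := by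
  refine addMul_le.mpr ⟨fun f hf => ?_, fun f hf => ?_⟩
  · rw [mem_colon] at hf ⊢
    exact ⟨hf.1, le_addMul _ _ _ hf.2⟩
  refine mem_colon.mpr ⟨isHomogeneous_linearForm_mul b hf, ?_⟩
  rw [mul_left_comm]
  exact mul_mem_addMul (isHomogeneous_linearForm_mul a hf) W

lemma addMul_addMul_comm (p r : MvPolynomial (Fin n) F) (d : ℕ)
    (W : Submodule F (MvPolynomial (Fin n) F)) :
    addMul p d (addMul r d W) = addMul r d (addMul p d W) :=
  sup_right_comm _ _ _

/-- Restricting to the hyperplane of `b` loses at most what is lost after first restricting to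
the hyperplane of `a`, plus what is lost on the residual space with respect to `a`. -/
lemma codim_addMul_le {a : Fin n → F} (ha : a ≠ 0) (b : Fin n → F) {d : ℕ}
    {W : Submodule F (MvPolynomial (Fin n) F)}
    (hW : W ≤ homogeneousSubmodule (Fin n) F (d + 2)) :
    codim (d + 2) (addMul (linearForm b) (d + 1) W) ≤
      codim (d + 2) (addMul (linearForm b) (d + 1) (addMul (linearForm a) (d + 1) W)) +
        codim (d + 1) (addMul (linearForm b) d (colon (linearForm a) (d + 1) W)) := by
  rw [← codim_addMul_add_codim_colon (linearForm_ne_zero ha) (d := d + 1)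
    (addMul_linearForm_le b hW), addMul_addMul_comm]
  gcongr
  exact codim_le_codim (addMul_colon_le_colon_addMul a b d W) inf_le_left

/-- `W` contains all multiples of the linear forms in `L` by forms of degree `d`. -/
def ContainsMul (L : Submodule F (Fin n → F)) (d : ℕ)
    (W : Submodule F (MvPolynomial (Fin n) F)) : Prop :=
  ∀ a ∈ L, ∀ f : MvPolynomial (Fin n) F, f.IsHomogeneous d → linearForm a * f ∈ W

lemma ContainsMul.addMul {L : Submodule F (Fin n → F)} {d : ℕ}
    {W : Submodule F (MvPolynomial (Fin n) F)} (h : ContainsMul L d W) (a : Fin n → F) :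
    ContainsMul (L ⊔ Submodule.span F {a}) d (addMul (linearForm a) d W) := by
  intro b hb f hf
  obtain ⟨c, hc, e, he, rfl⟩ := Submodule.mem_sup.mp hb
  obtain ⟨t, rfl⟩ := Submodule.mem_span_singleton.mp he
  rw [map_add, map_smul, add_mul, smul_mul_assoc]
  exact add_mem (le_addMul _ _ _ (h c hc f hf))
    (Submodule.smul_mem _ _ (mul_mem_addMul hf W))

lemma ContainsMul.colon {L : Submodule F (Fin n → F)} {d : ℕ}
    {W : Submodule F (MvPolynomial (Fin n) F)} (h : ContainsMul L (d + 1) W) (a : Fin n → F) :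
    ContainsMul L d (colon (linearForm a) (d + 1) W) := by
  intro b hb f hf
  refine mem_colon.mpr ⟨isHomogeneous_linearForm_mul b hf, ?_⟩
  rw [mul_left_comm]
  exact h b hb _ (isHomogeneous_linearForm_mul a hf)

lemma ContainsMul.addMul_eq {L : Submodule F (Fin n → F)} {d : ℕ}
    {W : Submodule F (MvPolynomial (Fin n) F)} (h : ContainsMul L d W) {b : Fin n → F}
    (hb : b ∈ L) : HyperplaneFurstenberg.addMul (linearForm b) d W = W :=
  le_antisymm (addMul_le.mpr ⟨le_rfl, h b hb⟩) (le_addMul _ _ _)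

lemma homogeneousSubmodule_le_of_containsMul_top {d : ℕ}
    {W : Submodule F (MvPolynomial (Fin n) F)} (h : ContainsMul ⊤ d W) :
    homogeneousSubmodule (Fin n) F (d + 1) ≤ W := by
  rw [← homogeneousSubmodule_one_pow, pow_succ', homogeneousSubmodule_one_pow, Submodule.mul_le]
  intro p hp f hf
  have hp' : p ∈ LinearMap.range (linearForm : (Fin n → F) →ₗ[F] _) := by
    rw [homogeneousSubmodule_one_eq_span_X] at hp
    simpa [linearForm, Fintype.range_linearCombination] using hp
  obtain ⟨a, rfl⟩ := hp'
  exact h a trivial f hf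

lemma codim_addMul_eq_zero {L : Submodule F (Fin n → F)} {a : Fin n → F} (ha : a ∉ L)
    (hL : finrank F L + 1 = n) {d : ℕ} {W : Submodule F (MvPolynomial (Fin n) F)}
    (hW : W ≤ homogeneousSubmodule (Fin n) F (d + 1)) (h : ContainsMul L d W) :
    codim (d + 1) (addMul (linearForm a) d W) = 0 := by
  have htop : L ⊔ Submodule.span F {a} = ⊤ := by
    apply Submodule.eq_top_of_finrank_eq
    rw [Submodule.finrank_sup_span_singleton ha, hL, Module.finrank_fin_fun]
  have h' := h.addMul a
  rw [htop] at h'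
  rw [le_antisymm (addMul_linearForm_le a hW) (homogeneousSubmodule_le_of_containsMul_top h'),
    codim, sub_self]

section Averaging

open scoped Classical in
/-- The vectors outside a subspace. -/
noncomputable def outside [Fintype F] (L : Submodule F (Fin n → F)) : Finset (Fin n → F) :=
  Finset.univ.filter (· ∉ L)

variable [Fintype F]

lemma mem_outside {L : Submodule F (Fin n → F)} {a : Fin n → F} : a ∈ outside L ↔ a ∉ L := by
  simp [outside]

lemma card_outside (L : Submodule F (Fin n → F)) :
    (outside L).card + Fintype.card F ^ finrank F L = Fintype.card F ^ n := by
  classical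
  have h := Finset.card_filter_add_card_filter_not (s := (Finset.univ : Finset (Fin n → F))) (· ∈ L)
  have hL : (Finset.univ.filter (· ∈ L)).card = Fintype.card F ^ finrank F L := by
    rw [← Module.card_eq_pow_finrank (K := F) (V := L), Fintype.card_subtype]
  simp only [Finset.card_univ, Fintype.card_fun, Fintype.card_fin] at h
  rw [← hL, ← h, outside, add_comm]

lemma outside_subset {L L' : Submodule F (Fin n → F)} (h : L ≤ L') : outside L' ⊆ outside L :=
  fun _ ha => mem_outside.mpr fun ha' => mem_outside.mp ha (h ha')

open scoped Classical in
lemma card_mul_card_sdiff_le {L : Submodule F (Fin n → F)} {a : Fin n → F} (ha : a ∉ L)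
    (hL : finrank F L + 2 ≤ n) :
    Fintype.card F * (outside L \ outside (L ⊔ Submodule.span F {a})).card ≤
      (outside L).card := by
  have hle : L ≤ L ⊔ Submodule.span F {a} := le_sup_left
  have h₁ := card_outside L
  have h₂ := card_outside (L ⊔ Submodule.span F {a})
  have h₃ := Finset.card_sdiff_add_card_eq_card (outside_subset hle)
  rw [Submodule.finrank_sup_span_singleton ha] at h₂
  obtain ⟨k, hk⟩ := Nat.exists_eq_add_of_le hL
  have hq : 1 ≤ Fintype.card F := Fintype.card_pos
  have hqk : 1 ≤ Fintype.card F ^ k := Nat.one_le_pow _ _ hq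
  have hn : Fintype.card F ^ n =
      Fintype.card F ^ finrank F L * Fintype.card F ^ 2 * Fintype.card F ^ k := by
    rw [← pow_add, ← pow_add, ← hk]
  rw [hn] at h₁ h₂
  rw [pow_succ] at h₂
  generalize Fintype.card F ^ finrank F L = y at *
  generalize Fintype.card F = q at *
  generalize q ^ k = Q at *
  nlinarith [Nat.mul_le_mul_left (y * q ^ 2) hqk, Nat.mul_le_mul_left y hq]

/-- An averaged form over a finite field of Green's hyperplane restriction theorem. -/
theorem min_mul_sum_codim_addMul_le (k : ℕ) : ∀ (d : ℕ) (L : Submodule F (Fin n → F))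
    (W : Submodule F (MvPolynomial (Fin n) F)), finrank F L + (k + 1) = n →
    W ≤ homogeneousSubmodule (Fin n) F (d + 1) → ContainsMul L d W →
    min ((d : ℝ) + 1) (Fintype.card F) *
      ∑ a ∈ outside L, codim (d + 1) (addMul (linearForm a) d W) ≤
      2 * k * ((outside L).card * codim (d + 1) W) := by
  classical
  induction k with
  | zero =>
    intro d L W hL hW h
    rw [Finset.sum_eq_zero fun a ha => codim_addMul_eq_zero (mem_outside.mp ha) hL hW h]
    simp
  | succ k ihk =>
    intro d
    induction d with
    | zero =>
      intro L W hL hW h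
      have hq : (1 : ℝ) ≤ Fintype.card F := by exact_mod_cast (Fintype.card_pos : 0 < Fintype.card F)
      have hsum : ∑ a ∈ outside L, codim (0 + 1) (addMul (linearForm a) 0 W) ≤
          (outside L).card * codim (0 + 1) W := by
        rw [← nsmul_eq_mul]
        exact Finset.sum_le_card_nsmul _ _ _ fun a _ =>
          codim_le_codim (le_addMul _ _ _) (addMul_linearForm_le a hW)
      have hnn : 0 ≤ (outside L).card * codim (0 + 1) W :=
        mul_nonneg (Nat.cast_nonneg _) (codim_nonneg hW)
      rw [Nat.cast_zero, zero_add (1 : ℝ), min_eq_left hq, one_mul]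
      push_cast
      nlinarith [mul_nonneg (Nat.cast_nonneg (α := ℝ) k) hnn]
    | succ d ihd =>
      intro L W hL hW h
      set T := ∑ a ∈ outside L, codim (d + 2) (addMul (linearForm a) (d + 1) W) with hT
      set c := codim (d + 2) W with hc
      set N : ℝ := ((outside L).card : ℝ) with hN
      set m : ℝ := min ((d : ℝ) + 1) (Fintype.card F) with hm
      have hm0 : 0 ≤ m := by positivity
      have hstep : ∀ a ∈ outside L, m * T ≤
          N * ((2 * (k + 1) : ℝ) * c - codim (d + 2) (addMul (linearForm a) (d + 1) W)) := by
        intro a ha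
        have haL := mem_outside.mp ha
        have ha0 : a ≠ 0 := fun h0 => haL (h0 ▸ L.zero_mem)
        set L' := L ⊔ Submodule.span F {a} with hL'
        set W' := addMul (linearForm a) (d + 1) W with hW'
        set Z := colon (linearForm a) (d + 1) W with hZ
        set c' := codim (d + 2) W' with hc'
        have hW'le : W' ≤ homogeneousSubmodule (Fin n) F (d + 2) := addMul_linearForm_le a hW
        have hfin : finrank F L' = finrank F L + 1 := Submodule.finrank_sup_span_singleton haL
        have hc'0 : 0 ≤ c' := codim_nonneg hW'le
        have hcc : codim (d + 1) Z = c - c' :=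
          eq_sub_of_add_eq' (codim_addMul_add_codim_colon (linearForm_ne_zero ha0) hW)
        have hsub : outside L' ⊆ outside L := outside_subset le_sup_left
        have hX := ihk (d + 1) L' W' (by omega) hW'le (h.addMul a)
        have hY := ihd L Z hL inf_le_left (h.colon a)
        rw [hcc] at hY
        set X := ∑ b ∈ outside L', codim (d + 2) (addMul (linearForm b) (d + 1) W') with hXdef
        set Y := ∑ b ∈ outside L, codim (d + 1) (addMul (linearForm b) d Z) with hYdef
        have hX0 : 0 ≤ X := Finset.sum_nonneg fun b _ => codim_nonneg (addMul_linearForm_le b hW'le)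
        have hsplit : T ≤ (outside L \ outside L').card * c' + X + Y := by
          calc T ≤ ∑ b ∈ outside L, (codim (d + 2) (addMul (linearForm b) (d + 1) W') +
                codim (d + 1) (addMul (linearForm b) d Z)) :=
                Finset.sum_le_sum fun b _ => codim_addMul_le ha0 b hW
            _ = ∑ b ∈ outside L \ outside L', codim (d + 2) (addMul (linearForm b) (d + 1) W') +
                X + Y := by
                rw [Finset.sum_add_distrib, Finset.sum_sdiff hsub]
            _ = _ := by
                congr 2
                rw [← nsmul_eq_mul]
                refine Finset.sum_eq_card_nsmul fun b hb => ?_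
                have hb' : b ∈ L' := by
                  have := (Finset.mem_sdiff.mp hb).2
                  rwa [mem_outside, not_not] at this
                rw [(h.addMul a).addMul_eq hb']
        have hB : m * ((outside L \ outside L').card : ℝ) ≤ N := by
          have h₁ : (Fintype.card F : ℝ) * (outside L \ outside L').card ≤ N := by
            rw [hN]
            exact_mod_cast card_mul_card_sdiff_le haL (by omega)
          exact (mul_le_mul_of_nonneg_right (min_le_right _ _) (Nat.cast_nonneg _)).trans h₁
        have hN' : ((outside L').card : ℝ) ≤ N := by
          rw [hN]
          exact_mod_cast Finset.card_le_card hsub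
        have hmX : m * X ≤ 2 * k * (N * c') := by
          refine (mul_le_mul_of_nonneg_right ?_ hX0).trans (hX.trans ?_)
          · exact min_le_min (by push_cast; linarith) le_rfl
          · gcongr
        push_cast at hY
        calc m * T ≤ m * ((outside L \ outside L').card * c' + X + Y) := by gcongr
          _ = m * (outside L \ outside L').card * c' + m * X + m * Y := by ring
          _ ≤ N * c' + 2 * k * (N * c') + 2 * (k + 1) * (N * (c - c')) := by gcongr
          _ = _ := by ring
      have hsum := Finset.sum_le_sum hstep
      rw [Finset.sum_const, ← Finset.mul_sum, Finset.sum_sub_distrib, Finset.sum_const,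
        nsmul_eq_mul, nsmul_eq_mul, ← hT, ← hN] at hsum
      have hNpos : 0 < N := by
        rw [hN, Nat.cast_pos]
        have := card_outside L
        have hlt : Fintype.card F ^ finrank F L < Fintype.card F ^ n :=
          Nat.pow_lt_pow_right Fintype.one_lt_card (by omega)
        omega
      have hmT := le_of_mul_le_mul_left hsum hNpos
      have hT0 : 0 ≤ T := Finset.sum_nonneg fun b _ => codim_nonneg (addMul_linearForm_le b hW)
      have hmin : min (((d + 1 : ℕ) : ℝ) + 1) (Fintype.card F) ≤ m + 1 := by
        rw [hm, ← min_add_add_right, Nat.cast_succ]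
        exact min_le_min_left _ (le_add_of_nonneg_right zero_le_one)
      have hmin' := mul_le_mul_of_nonneg_right hmin hT0
      refine hmin'.trans ?_
      rw [add_one_mul, Nat.cast_succ]
      linarith only [hmT]

end Averaging

/-- The quotient map by an ideal, as a linear map over the base field. -/
noncomputable def quotMap (I : Ideal (MvPolynomial (Fin n) F)) :
    MvPolynomial (Fin n) F →ₗ[F] MvPolynomial (Fin n) F ⧸ I :=
  (Ideal.Quotient.mkₐ F I).toLinearMap

lemma quotMap_surjective (I : Ideal (MvPolynomial (Fin n) F)) :
    Function.Surjective (quotMap I) := Ideal.Quotient.mk_surjective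

lemma quotMap_eq_zero {I : Ideal (MvPolynomial (Fin n) F)} {f : MvPolynomial (Fin n) F} :
    quotMap I f = 0 ↔ f ∈ I := Ideal.Quotient.eq_zero_iff_mem

/-- The forms of degree `d` in the ideal `I`. -/
noncomputable def formsIn (I : Ideal (MvPolynomial (Fin n) F)) (d : ℕ) :
    Submodule F (MvPolynomial (Fin n) F) :=
  homogeneousSubmodule (Fin n) F d ⊓ I.restrictScalars F

lemma mem_formsIn {I : Ideal (MvPolynomial (Fin n) F)} {d : ℕ} {f : MvPolynomial (Fin n) F} :
    f ∈ formsIn I d ↔ f.IsHomogeneous d ∧ f ∈ I := Iff.rfl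

lemma finrank_map_quotMap (I : Ideal (MvPolynomial (Fin n) F)) (d : ℕ) :
    (finrank F ((homogeneousSubmodule (Fin n) F d).map (quotMap I)) : ℝ) =
      codim d (formsIn I d) := by
  have h := ((quotMap I).domRestrict (homogeneousSubmodule (Fin n) F d)).finrank_range_add_finrank_ker
  rw [LinearMap.range_domRestrict] at h
  have hker : (LinearMap.ker ((quotMap I).domRestrict (homogeneousSubmodule (Fin n) F d))).map
      (homogeneousSubmodule (Fin n) F d).subtype = formsIn I d := by
    ext f
    simp [mem_formsIn, quotMap_eq_zero, and_comm]
  rw [(Submodule.equivSubtypeMap _ (LinearMap.ker _)).finrank_eq, hker] at h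
  rw [codim, ← h]
  push_cast
  ring

lemma finrank_map_sup_le {V : Type*} [AddCommGroup V] [Module F V]
    (φ : MvPolynomial (Fin n) F →ₗ[F] V) (s : Finset ℕ) :
    finrank F ((s.sup (homogeneousSubmodule (Fin n) F)).map φ) ≤
      ∑ d ∈ s, finrank F ((homogeneousSubmodule (Fin n) F d).map φ) := by
  classical
  induction s using Finset.induction_on with
  | empty => simp
  | insert d s hd ih =>
    rw [Finset.sup_insert, Submodule.map_sup, Finset.sum_insert hd]
    have : FiniteDimensional F (s.sup (homogeneousSubmodule (Fin n) F) :
      Submodule F (MvPolynomial (Fin n) F)) := Submodule.finiteDimensional_finset_sup _ _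
    exact (Submodule.finrank_add_le_finrank_add_finrank _ _).trans (by gcongr)

lemma homogeneousComponent_eq_zero_of_mem_sup {s : Finset ℕ} {d : ℕ} (hd : d ∉ s)
    {f : MvPolynomial (Fin n) F} (hf : f ∈ s.sup (homogeneousSubmodule (Fin n) F)) :
    homogeneousComponent d f = 0 := by
  have h : s.sup (homogeneousSubmodule (Fin n) F) ≤ LinearMap.ker (homogeneousComponent d) := by
    refine Finset.sup_le fun e he g hg => ?_
    rw [LinearMap.mem_ker, homogeneousComponent_of_mem hg, if_neg]
    rintro rfl
    exact hd he
  exact h hf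

lemma sum_finrank_map_quotMap_le {I : Ideal (MvPolynomial (Fin n) F)} (hI : IsHomogeneousIdeal I)
    (s : Finset ℕ) :
    ∑ d ∈ s, finrank F ((homogeneousSubmodule (Fin n) F d).map (quotMap I)) ≤
      finrank F ((s.sup (homogeneousSubmodule (Fin n) F)).map (quotMap I)) := by
  classical
  induction s using Finset.induction_on with
  | empty => simp
  | insert d s hd ih =>
    rw [Finset.sup_insert, Submodule.map_sup, Finset.sum_insert hd]
    have : FiniteDimensional F (s.sup (homogeneousSubmodule (Fin n) F) :
      Submodule F (MvPolynomial (Fin n) F)) := Submodule.finiteDimensional_finset_sup _ _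
    have hdis : (homogeneousSubmodule (Fin n) F d).map (quotMap I) ⊓
        (s.sup (homogeneousSubmodule (Fin n) F)).map (quotMap I) = ⊥ := by
      rw [eq_bot_iff]
      rintro _ ⟨⟨f, hf, rfl⟩, g, hg, hfg⟩
      have hmem : f - g ∈ I := by
        rw [← quotMap_eq_zero, map_sub, hfg, sub_self]
      have hcomp := hI _ hmem d
      rw [map_sub, homogeneousComponent_eq_zero_of_mem_sup hd hg, sub_zero,
        homogeneousComponent_eq_self hf] at hcomp
      exact quotMap_eq_zero.mpr hcomp
    have hadd := Submodule.finrank_sup_add_finrank_inf_eq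
      ((homogeneousSubmodule (Fin n) F d).map (quotMap I))
      ((s.sup (homogeneousSubmodule (Fin n) F)).map (quotMap I))
    rw [hdis, finrank_bot, add_zero] at hadd
    rw [hadd]
    gcongr

lemma sum_codim_formsIn_le {I : Ideal (MvPolynomial (Fin n) F)} (hI : IsHomogeneousIdeal I)
    [FiniteDimensional F (MvPolynomial (Fin n) F ⧸ I)] (s : Finset ℕ) :
    ∑ d ∈ s, codim d (formsIn I d) ≤ (finrank F (MvPolynomial (Fin n) F ⧸ I) : ℝ) := by
  simp_rw [← finrank_map_quotMap]
  exact_mod_cast (sum_finrank_map_quotMap_le hI s).trans (Submodule.finrank_le _)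

lemma exists_sup_sup_eq_top (I : Ideal (MvPolynomial (Fin n) F))
    [FiniteDimensional F (MvPolynomial (Fin n) F ⧸ I)] :
    ∃ s : Finset ℕ, I.restrictScalars F ⊔ s.sup (homogeneousSubmodule (Fin n) F) = ⊤ := by
  have hc : IsCompactElement (⊤ : Submodule F (MvPolynomial (Fin n) F ⧸ I)) :=
    (Submodule.fg_iff_compact _).mp Module.Finite.fg_top
  obtain ⟨s, hs⟩ := CompleteLattice.IsCompactElement.exists_finset_of_le_iSup _ hc
    (fun d => (homogeneousSubmodule (Fin n) F d).map (quotMap I)) (by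
      rw [← Submodule.map_iSup]
      rintro x -
      obtain ⟨f, rfl⟩ := quotMap_surjective I x
      refine ⟨f, ?_, rfl⟩
      rw [← sum_homogeneousComponent f]
      exact sum_mem fun d _ =>
        (le_iSup (homogeneousSubmodule (Fin n) F) d) (homogeneousComponent_mem d f))
  refine ⟨s, eq_top_iff.mpr fun f _ => ?_⟩
  simp_rw [← Submodule.map_iSup] at hs
  obtain ⟨g, hg, hgf⟩ := hs (Submodule.mem_top : quotMap I f ∈ ⊤)
  rw [← Finset.sup_eq_iSup] at hg
  rw [← sub_add_cancel f g]
  refine Submodule.add_mem_sup ?_ hg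
  change f - g ∈ I
  rw [← quotMap_eq_zero, map_sub, hgf, sub_self]

lemma finrank_quotient_le_sum_codim {J : Ideal (MvPolynomial (Fin n) F)} {s : Finset ℕ}
    (hs : J.restrictScalars F ⊔ s.sup (homogeneousSubmodule (Fin n) F) = ⊤) :
    (finrank F (MvPolynomial (Fin n) F ⧸ J) : ℝ) ≤ ∑ d ∈ s, codim d (formsIn J d) := by
  have hmap : (s.sup (homogeneousSubmodule (Fin n) F)).map (quotMap J) = ⊤ := by
    have hJ : (J.restrictScalars F).map (quotMap J) = ⊥ := by
      rw [eq_bot_iff]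
      rintro _ ⟨f, hf, rfl⟩
      exact quotMap_eq_zero.mpr hf
    have h := congrArg (Submodule.map (quotMap J)) hs
    rwa [Submodule.map_sup, hJ, bot_sup_eq, Submodule.map_top,
      LinearMap.range_eq_top.mpr (quotMap_surjective J)] at h
  have h := finrank_map_sup_le (quotMap J) s
  rw [hmap, finrank_top] at h
  simp_rw [← finrank_map_quotMap]
  exact_mod_cast h

lemma finrank_homogeneousSubmodule_le (k T : ℕ) :
    finrank F (homogeneousSubmodule (Fin (k + 1)) F T) ≤ (T + 1) ^ k := by
  let φ : MvPolynomial (Fin (k + 1)) F →ₗ[F] ((Fin k → Fin (T + 1)) → F) :=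
    LinearMap.pi fun e =>
      lcoeff F (Finsupp.equivFunOnFinite.symm
        (Fin.cons (T - ∑ i, (e i : ℕ)) fun i => (e i : ℕ)))
  have hφ : Function.Injective (φ.domRestrict (homogeneousSubmodule (Fin (k + 1)) F T)) := by
    rw [← LinearMap.ker_eq_bot, eq_bot_iff]
    rintro ⟨f, hf⟩ h
    rw [LinearMap.mem_ker] at h
    rw [Submodule.mem_bot, Submodule.mk_eq_zero]
    ext u
    rw [coeff_zero]
    by_contra hu
    have hdeg : u.degree = T := by
      rw [Finsupp.degree_eq_weight_one]
      exact hf hu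
    rw [Finsupp.degree_eq_sum, Fin.sum_univ_succ] at hdeg
    have hlt : ∀ i : Fin k, u i.succ < T + 1 := fun i => by
      have := Finset.single_le_sum (f := fun i : Fin k => u i.succ) (fun _ _ => Nat.zero_le _)
        (Finset.mem_univ i)
      omega
    have hu' : Finsupp.equivFunOnFinite.symm
        (Fin.cons (T - ∑ i : Fin k, u i.succ) fun i => u i.succ) = u := by
      ext i
      refine Fin.cases ?_ (fun i => ?_) i
      · simp only [Finsupp.equivFunOnFinite_symm_apply_apply, Fin.cons_zero]
        omega
      · simp
    have h' : coeff (Finsupp.equivFunOnFinite.symm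
        (Fin.cons (T - ∑ i : Fin k, u i.succ) fun i => u i.succ)) f = 0 :=
      congrFun h fun i => ⟨u i.succ, hlt i⟩
    rw [hu'] at h'
    exact hu h'
  have h := LinearMap.finrank_le_finrank_of_injective hφ
  simpa using h

lemma sum_range_codim_formsIn_le {a : Fin n → F} (ha : a ≠ 0)
    {J : Ideal (MvPolynomial (Fin n) F)} (hJ : linearForm a ∈ J) (T : ℕ) :
    ∑ d ∈ Finset.range (T + 1), codim d (formsIn J d) ≤
      (finrank F (homogeneousSubmodule (Fin n) F T) : ℝ) := by
  induction T with
  | zero => simp [codim]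
  | succ T ih =>
    rw [Finset.sum_range_succ]
    have h : codim (T + 1) (formsIn J (T + 1)) ≤
        codim (T + 1) ((homogeneousSubmodule (Fin n) F T).map
          (LinearMap.mulLeft F (linearForm a))) := by
      refine codim_le_codim ?_ inf_le_left
      rintro _ ⟨f, hf, rfl⟩
      exact ⟨isHomogeneous_linearForm_mul a hf, Ideal.mul_mem_right _ _ hJ⟩
    have hinj : Function.Injective (LinearMap.mulLeft F (linearForm a)) :=
      mul_right_injective₀ (linearForm_ne_zero ha)
    have hfin := (Submodule.equivMapOfInjective _ hinj
      (homogeneousSubmodule (Fin n) F T)).finrank_eq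
    rw [codim.eq_def _ (Submodule.map _ _), ← hfin] at h
    linarith

lemma codim_formsIn_sup_le (a : Fin n → F) (I : Ideal (MvPolynomial (Fin n) F)) (d : ℕ) :
    codim (d + 1) (formsIn (I ⊔ Ideal.span {linearForm a}) (d + 1)) ≤
      codim (d + 1) (addMul (linearForm a) d (formsIn I (d + 1))) := by
  refine codim_le_codim (addMul_le.mpr ⟨fun f hf => ?_, fun f hf => ?_⟩) inf_le_left
  · exact ⟨hf.1, Ideal.mem_sup_left hf.2⟩
  · exact ⟨isHomogeneous_linearForm_mul a hf, Ideal.mem_sup_right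
      (Ideal.mul_mem_right _ _ (Ideal.mem_span_singleton_self _))⟩

/-- If every hyperplane is `m`-rich then, for every `T` below the size of the field, the total
dimension `N` satisfies `(T + 1) * (m - (T + 1) ^ k) ≤ 2 * k * N`. -/
theorem mul_sub_pow_le_finrank {k : ℕ} [Fintype F] {I : Ideal (MvPolynomial (Fin (k + 1)) F)}
    (hI : IsHomogeneousIdeal I) [FiniteDimensional F (MvPolynomial (Fin (k + 1)) F ⧸ I)] {m : ℝ}
    (hm : ∀ a : Fin (k + 1) → F, a ≠ 0 →
      m ≤ (finrank F (MvPolynomial (Fin (k + 1)) F ⧸ (I ⊔ Ideal.span {linearForm a})) : ℝ))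
    {T : ℕ} (hT : T + 1 ≤ Fintype.card F) :
    ((T : ℝ) + 1) * (m - ((T : ℝ) + 1) ^ k) ≤
      2 * k * (finrank F (MvPolynomial (Fin (k + 1)) F ⧸ I) : ℝ) := by
  classical
  obtain ⟨s, hs⟩ := exists_sup_sup_eq_top I
  set S := s \ Finset.range (T + 1)
  set A := outside (⊥ : Submodule F (Fin (k + 1) → F))
  have hA {a : Fin (k + 1) → F} (ha : a ∈ A) : a ≠ 0 := mem_outside.mp ha
  have hApos : (0 : ℝ) < A.card := by
    rw [Nat.cast_pos, Finset.card_pos]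
    exact ⟨1, mem_outside.mpr one_ne_zero⟩
  have hlow : ∀ a ∈ A, m - ((T : ℝ) + 1) ^ k ≤
      ∑ d ∈ S, codim d (formsIn (I ⊔ Ideal.span {linearForm a}) d) := by
    intro a ha
    set J := I ⊔ Ideal.span {linearForm a} with hJ
    have htop : J.restrictScalars F ⊔ s.sup (homogeneousSubmodule (Fin (k + 1)) F) = ⊤ := by
      refine eq_top_iff.mpr (hs.ge.trans (sup_le_sup_right ?_ _))
      exact fun f hf => Ideal.mem_sup_left hf
    have h₁ := (hm a (hA ha)).trans (finrank_quotient_le_sum_codim htop)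
    have h₂ : ∑ d ∈ Finset.range (T + 1), codim d (formsIn J d) ≤ ((T : ℝ) + 1) ^ k :=
      (sum_range_codim_formsIn_le (hA ha)
        (Ideal.mem_sup_right (Ideal.mem_span_singleton_self _)) T).trans
        (by exact_mod_cast finrank_homogeneousSubmodule_le k T)
    have h₃ : ∑ d ∈ s, codim d (formsIn J d) ≤
        ∑ d ∈ S, codim d (formsIn J d) + ∑ d ∈ Finset.range (T + 1), codim d (formsIn J d) := by
      rw [← Finset.sum_inter_add_sum_sdiff s (Finset.range (T + 1)), add_comm]
      gcongr
      · exact fun d _ _ => codim_nonneg (W := formsIn J d) inf_le_left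
      · exact Finset.inter_subset_right
    linarith
  have hhigh : ∀ d ∈ S, ((T : ℝ) + 1) *
      ∑ a ∈ A, codim d (formsIn (I ⊔ Ideal.span {linearForm a}) d) ≤
        2 * k * (A.card * codim d (formsIn I d)) := by
    intro d hd
    obtain ⟨e, rfl⟩ : ∃ e, d = e + 1 := Nat.exists_eq_succ_of_ne_zero (by
      rintro rfl
      simp [S] at hd)
    have hTe : T ≤ e := by
      have := (Finset.mem_sdiff.mp hd).2
      rw [Finset.mem_range] at this
      omega
    have h := min_mul_sum_codim_addMul_le k e ⊥ (formsIn I (e + 1)) (by simp) inf_le_left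
      (by
        intro a ha f _
        rw [(Submodule.mem_bot F).mp ha, map_zero, zero_mul]
        exact zero_mem _)
    refine le_trans ?_ h
    refine mul_le_mul ?_ (Finset.sum_le_sum fun a _ => codim_formsIn_sup_le a I e)
      (Finset.sum_nonneg fun _ _ => codim_nonneg inf_le_left) (by positivity)
    exact le_min (by exact_mod_cast Nat.succ_le_succ hTe) (by exact_mod_cast hT)
  refine le_of_mul_le_mul_left ?_ hApos
  calc (A.card : ℝ) * (((T : ℝ) + 1) * (m - ((T : ℝ) + 1) ^ k))
      = ((T : ℝ) + 1) * ∑ _a ∈ A, (m - ((T : ℝ) + 1) ^ k) := by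
        rw [Finset.sum_const, nsmul_eq_mul]
        ring
    _ ≤ ((T : ℝ) + 1) *
        ∑ a ∈ A, ∑ d ∈ S, codim d (formsIn (I ⊔ Ideal.span {linearForm a}) d) := by
        gcongr with a ha
        exact hlow a ha
    _ = ∑ d ∈ S, ((T : ℝ) + 1) *
        ∑ a ∈ A, codim d (formsIn (I ⊔ Ideal.span {linearForm a}) d) := by
        rw [Finset.sum_comm, Finset.mul_sum]
    _ ≤ ∑ d ∈ S, 2 * k * (A.card * codim d (formsIn I d)) := Finset.sum_le_sum hhigh
    _ = A.card * (2 * k * ∑ d ∈ S, codim d (formsIn I d)) := by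
        rw [← Finset.mul_sum, ← Finset.mul_sum]
        ring
    _ ≤ _ := by
        gcongr
        exact sum_codim_formsIn_le hI S

lemma finrank_quotient_sup_le (I J : Ideal (MvPolynomial (Fin n) F))
    [FiniteDimensional F (MvPolynomial (Fin n) F ⧸ I)] :
    finrank F (MvPolynomial (Fin n) F ⧸ (I ⊔ J)) ≤ finrank F (MvPolynomial (Fin n) F ⧸ I) :=
  LinearMap.finrank_le_finrank_of_surjective (f := (Ideal.Quotient.factorₐ F
    (le_sup_left : I ≤ I ⊔ J)).toLinearMap) (Ideal.Quotient.factor_surjective le_sup_left)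

end HyperplaneFurstenberg

/-- **Hyperplane case of the Furstenberg scheme bound.** If every hyperplane
through the origin is `q^c`-rich for the homogeneous 0-dimensional scheme defined
by `I`, then `N ≥ C·q^{cn/(n-1)}`. -/
theorem hyperplane_furstenberg_schemes (n : ℕ) (hn : 2 ≤ n) :
    ∃ C : ℝ, 0 < C ∧
      ∀ (c : ℝ), 0 ≤ c → c ≤ ((n : ℝ) - 1) →
      ∀ (F : Type) [Field F] [Fintype F],
      ∀ I : Ideal (MvPolynomial (Fin n) F),
        IsHomogeneousIdeal I →
        FiniteDimensional F (MvPolynomial (Fin n) F ⧸ I) →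
        (∀ a : Fin n → F, a ≠ 0 →
          (Fintype.card F : ℝ) ^ c ≤
            (Module.finrank F (MvPolynomial (Fin n) F ⧸
              (I + Ideal.span {∑ i, MvPolynomial.C (a i) * MvPolynomial.X i})) : ℝ)) →
        C * (Fintype.card F : ℝ) ^ (c * n / (n - 1)) ≤
          (Module.finrank F (MvPolynomial (Fin n) F ⧸ I) : ℝ) := by
  obtain ⟨k, rfl⟩ : ∃ k, n = k + 1 := ⟨n - 1, by omega⟩
  have hk : (1 : ℝ) ≤ k := by exact_mod_cast Nat.le_of_succ_le_succ hn
  refine ⟨1 / (16 * k), by positivity, ?_⟩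
  intro c hc0 hc F _ _ I hI _ hrich
  have hq : (1 : ℝ) ≤ Fintype.card F := by exact_mod_cast (Fintype.card_pos : 0 < Fintype.card F)
  have hrich' : ∀ a : Fin (k + 1) → F, a ≠ 0 → (Fintype.card F : ℝ) ^ c ≤
      (Module.finrank F (MvPolynomial (Fin (k + 1)) F ⧸
        (I ⊔ Ideal.span {HyperplaneFurstenberg.linearForm a})) : ℝ) := by
    intro a ha
    rw [HyperplaneFurstenberg.linearForm_apply]
    exact hrich a ha
  push_cast at hc ⊢
  rw [add_sub_cancel_right] at hc ⊢
  set q : ℝ := (Fintype.card F : ℝ) with hqdef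
  set D : ℝ := q ^ (c / k) with hD
  set N : ℝ := (Module.finrank F (MvPolynomial (Fin (k + 1)) F ⧸ I) : ℝ) with hN
  have hD1 : 1 ≤ D := Real.one_le_rpow hq (by positivity)
  have hDq : D ≤ q := by
    calc D ≤ q ^ (1 : ℝ) := Real.rpow_le_rpow_of_exponent_le hq ((div_le_one (by positivity)).mpr hc)
      _ = q := Real.rpow_one q
  have hDk : q ^ c = D ^ k := by
    rw [hD, ← Real.rpow_natCast, ← Real.rpow_mul (by positivity), div_mul_cancel₀ _ (by positivity)]
  have hDn : q ^ (c * (k + 1) / k) = D * D ^ k := by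
    rw [← hDk, hD, ← Real.rpow_add (by positivity)]
    congr 1
    field_simp
    ring
  rw [hDk] at hrich'
  rw [hDn, div_mul_eq_mul_div, one_mul, div_le_iff₀ (by positivity)]
  have hmN : D ^ k ≤ N := by
    refine (hrich' 1 one_ne_zero).trans ?_
    rw [hN]
    exact_mod_cast HyperplaneFurstenberg.finrank_quotient_sup_le I _
  have hDpos : 0 < D ^ k := by positivity
  rcases lt_or_ge D 2 with hD2 | hD2
  · nlinarith
  · obtain ⟨T, hT⟩ : ∃ T, ⌊D / 2⌋₊ = T + 1 := Nat.exists_eq_succ_of_ne_zero (by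
      rw [← Nat.one_le_iff_ne_zero, Nat.le_floor_iff (by positivity)]
      push_cast
      linarith)
    have hle : (T : ℝ) + 1 ≤ D / 2 := by
      have := Nat.floor_le (show 0 ≤ D / 2 by positivity)
      rw [hT] at this
      exact_mod_cast this
    have hlt : D / 2 < (T : ℝ) + 1 + 1 := by
      have := Nat.lt_floor_add_one (D / 2)
      rw [hT] at this
      exact_mod_cast this
    have hTq : T + 1 ≤ Fintype.card F := by
      have : (T : ℝ) + 1 ≤ Fintype.card F := by linarith
      exact_mod_cast this
    have h := HyperplaneFurstenberg.mul_sub_pow_le_finrank hI hrich' hTq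
    have hpow : ((T : ℝ) + 1) ^ k ≤ D ^ k / 2 := by
      calc ((T : ℝ) + 1) ^ k ≤ (D / 2) ^ k := by gcongr
        _ = D ^ k / 2 ^ k := div_pow _ _ _
        _ ≤ D ^ k / 2 := by
          gcongr
          exact le_self_pow₀ one_le_two (by omega)
    have hT0 : (0 : ℝ) ≤ T := Nat.cast_nonneg T
    have h₁ : D / 4 * (D ^ k / 2) ≤ ((T : ℝ) + 1) * (D ^ k - ((T : ℝ) + 1) ^ k) := by
      apply mul_le_mul <;> linarith
    linarith
end

section
/- Let 𝕜 be a field and let I ⊆ 𝕜[x₁,…,xₙ] be an ideal such that dim_𝕜 𝕜[x₁,…,xₙ]/I is finite. Then dim_𝕜 𝕜[x₁,…,xₙ]/in(I) = dim_𝕜 𝕜[x₁,…,xₙ]/I, where in(I) is the ideal generated by the top-degree forms of the nonzero elements of I. In other words, the dilation degeneration S₀ of a 0-dimensional scheme S satisfies |S₀| = |S|. -/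
open MvPolynomial

/-- The top-degree form of a polynomial: its homogeneous component in degree
equal to its total degree. -/
noncomputable def topForm {𝕜 : Type} [Field 𝕜] {n : ℕ}
    (f : MvPolynomial (Fin n) 𝕜) : MvPolynomial (Fin n) 𝕜 :=
  MvPolynomial.homogeneousComponent f.totalDegree f

/-- `in(I)`: the ideal generated by the top-degree forms of the nonzero elements
of `I`; the defining ideal of the dilation degeneration `S₀`. -/
noncomputable def inIdeal {𝕜 : Type} [Field 𝕜] {n : ℕ}
    (I : Ideal (MvPolynomial (Fin n) 𝕜)) : Ideal (MvPolynomial (Fin n) 𝕜) :=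
  Ideal.span {g | ∃ f ∈ I, f ≠ 0 ∧ g = topForm f}

section TopForm

variable {𝕜 : Type} [Field 𝕜] {n : ℕ}

lemma topForm_ne_zero {f : MvPolynomial (Fin n) 𝕜} (hf : f ≠ 0) : topForm f ≠ 0 := by
  have hne : f.support.Nonempty := support_nonempty.mpr hf
  obtain ⟨m, hm, hmax⟩ := f.support.exists_mem_eq_sup hne (fun s => s.sum fun _ e => e)
  intro h
  have hc := congrArg (coeff m) h
  have hdeg : m.degree = f.totalDegree := hmax.symm
  rw [topForm, coeff_homogeneousComponent, if_pos hdeg, coeff_zero] at hc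
  exact mem_support_iff.mp hm hc

lemma topForm_mem_inIdeal {I : Ideal (MvPolynomial (Fin n) 𝕜)} {f : MvPolynomial (Fin n) 𝕜}
    (hf : f ∈ I) (hf0 : f ≠ 0) : topForm f ∈ inIdeal I :=
  Ideal.subset_span ⟨f, hf, hf0, rfl⟩

/-- The homogeneous component in degree `d` of an element `p` of `inIdeal I` is the degree `d`
part of an element of `I` without terms of degree larger than `d`. -/
lemma exists_mem_coeff_eq_of_mem_inIdeal {I : Ideal (MvPolynomial (Fin n) 𝕜)}
    {p : MvPolynomial (Fin n) 𝕜} (hp : p ∈ inIdeal I) (d : ℕ) :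
    ∃ g ∈ I, ∀ m : Fin n →₀ ℕ, d ≤ m.degree →
      coeff m g = coeff m (homogeneousComponent d p) := by
  induction hp using Submodule.span_induction generalizing d with
  | mem x hx =>
    obtain ⟨f, hf, -, rfl⟩ := hx
    rw [topForm, homogeneousComponent_of_mem (homogeneousComponent_mem _ _)]
    split_ifs with h
    · subst h
      refine ⟨f, hf, fun m hm => ?_⟩
      rw [coeff_homogeneousComponent]
      split_ifs with h'
      · rfl
      · exact coeff_eq_zero_of_totalDegree_lt (lt_of_le_of_ne hm (Ne.symm h'))
    · exact ⟨0, I.zero_mem, fun _ _ => rfl⟩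
  | zero => exact ⟨0, I.zero_mem, fun _ _ => by simp⟩
  | add x y _ _ hx hy =>
    obtain ⟨g, hg, hgc⟩ := hx d
    obtain ⟨k, hk, hkc⟩ := hy d
    exact ⟨g + k, I.add_mem hg hk, fun m hm => by simp [hgc m hm, hkc m hm]⟩
  | smul a x _ hx =>
    rw [smul_eq_mul]
    induction a using MvPolynomial.induction_on generalizing d with
    | C r =>
      obtain ⟨g, hg, hgc⟩ := hx d
      exact ⟨C r * g, I.mul_mem_left _ hg, fun m hm => by
        simp only [homogeneousComponent_C_mul, coeff_C_mul, hgc m hm]⟩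
    | add a b ha hb =>
      obtain ⟨g, hg, hgc⟩ := ha d
      obtain ⟨k, hk, hkc⟩ := hb d
      exact ⟨g + k, I.add_mem hg hk, fun m hm => by
        simp [add_mul, hgc m hm, hkc m hm]⟩
    | mul_X a i ha =>
      rw [mul_right_comm]
      cases d with
      | zero => exact ⟨0, I.zero_mem, fun m _ => by simp [coeff_mul_X']⟩
      | succ d =>
        obtain ⟨g, hg, hgc⟩ := ha d
        refine ⟨g * X i, I.mul_mem_right _ hg, fun m hm => ?_⟩
        rw [coeff_homogeneousComponent, coeff_mul_X', coeff_mul_X']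
        split_ifs with hi hd hd
        all_goals try rfl
        all_goals
          have hle : Finsupp.single i 1 ≤ m :=
            Finsupp.single_le_iff.mpr (Nat.one_le_iff_ne_zero.mpr (Finsupp.mem_support_iff.mp hi))
          have hsum : (m - Finsupp.single i 1).degree + 1 = m.degree := by
            conv_rhs => rw [← tsub_add_cancel_of_le hle, map_add, Finsupp.degree_single]
          rw [hgc _ (by omega), coeff_homogeneousComponent]
        · rw [if_pos (by omega)]
        · rw [if_neg (by omega)]

lemma homogeneousComponent_mem_restrictSupport {S : Set (Fin n →₀ ℕ)}
    {p : MvPolynomial (Fin n) 𝕜} (hp : p ∈ restrictSupport 𝕜 S) (d : ℕ) :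
    homogeneousComponent d p ∈ restrictSupport 𝕜 S := by
  rw [mem_restrictSupport_iff, support_homogeneousComponent] at *
  exact fun m hm => hp (Finset.mem_filter.mp hm).1

/-- Every ideal has a complement spanned by monomials. -/
lemma exists_isCompl_restrictSupport (J : Ideal (MvPolynomial (Fin n) 𝕜)) :
    ∃ S : Set (Fin n →₀ ℕ), IsCompl (J.restrictScalars 𝕜) (restrictSupport 𝕜 S) := by
  set q := (J.restrictScalars 𝕜).mkQ with hq
  set v : (Fin n →₀ ℕ) → MvPolynomial (Fin n) 𝕜 := fun m => monomial m 1 with hv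
  obtain ⟨κ, a, -, hspan, hli⟩ := exists_linearIndependent' 𝕜 (q ∘ v)
  have hW : restrictSupport 𝕜 (Set.range a) = Submodule.span 𝕜 (Set.range (v ∘ a)) := by
    rw [restrictSupport_eq_span, Set.range_comp]
  refine ⟨Set.range a, ?_, ?_⟩
  · rw [hW]
    have := Submodule.range_ker_disjoint (f := q) (v := v ∘ a) hli
    rw [hq, Submodule.ker_mkQ] at this
    exact this.symm
  · rw [codisjoint_iff, ← Submodule.map_mkQ_eq_top, hW, Submodule.map_span, ← Set.range_comp,
      ← hq, ← Function.comp_assoc, hspan, Set.range_comp, ← Submodule.map_span]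
    have htop : Submodule.span 𝕜 (Set.range v) = ⊤ := by
      rw [← restrictSupport_univ, restrictSupport_eq_span, Set.image_univ]
    rw [htop, Submodule.map_top, hq, Submodule.range_mkQ]

/-- A complement of `inIdeal I` spanned by monomials is also a complement of `I`. -/
lemma isCompl_restrictSupport_of_inIdeal {I : Ideal (MvPolynomial (Fin n) 𝕜)}
    {S : Set (Fin n →₀ ℕ)}
    (h : IsCompl ((inIdeal I).restrictScalars 𝕜) (restrictSupport 𝕜 S)) :
    IsCompl (I.restrictScalars 𝕜) (restrictSupport 𝕜 S) := by
  constructor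
  · rw [Submodule.disjoint_def]
    intro p hpI hpW
    by_contra hp
    exact topForm_ne_zero hp (Submodule.disjoint_def.mp h.disjoint _
      (topForm_mem_inIdeal hpI hp) (homogeneousComponent_mem_restrictSupport hpW _))
  · rw [codisjoint_iff, eq_top_iff]
    have key : ∀ (d : ℕ) (f : MvPolynomial (Fin n) 𝕜),
        (∀ m : Fin n →₀ ℕ, d ≤ m.degree → coeff m f = 0) →
        f ∈ I.restrictScalars 𝕜 ⊔ restrictSupport 𝕜 S := by
      intro d
      induction d with
      | zero =>
        intro f hf
        rw [show f = 0 from MvPolynomial.ext _ _ fun m => hf m (Nat.zero_le _)]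
        exact Submodule.zero_mem _
      | succ d ih =>
        intro f hf
        obtain ⟨j, hj, w, hw, hjw⟩ :=
          Submodule.mem_sup.mp (h.sup_eq_top ▸ Submodule.mem_top :
            f ∈ (inIdeal I).restrictScalars 𝕜 ⊔ restrictSupport 𝕜 S)
        obtain ⟨g, hg, hgc⟩ := exists_mem_coeff_eq_of_mem_inIdeal hj d
        have hw' := homogeneousComponent_mem_restrictSupport hw d
        have hrest := ih (f - (g + homogeneousComponent d w)) fun m hm => by
          rw [coeff_sub, coeff_add, hgc m hm, ← coeff_add, ← map_add, hjw,
            coeff_homogeneousComponent]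
          split_ifs with hd
          · exact sub_self _
          · rw [hf m (by omega), sub_zero]
        rw [← sub_add_cancel f (g + homogeneousComponent d w)]
        exact Submodule.add_mem _ hrest (Submodule.add_mem_sup hg hw')
    exact fun f _ => key (f.totalDegree + 1) f fun m hm =>
      coeff_eq_zero_of_totalDegree_lt (Nat.lt_of_succ_le hm)

end TopForm

/-- The dilation degeneration `S₀` of a 0-dimensional scheme `S` satisfies
`|S₀| = |S|`, i.e. `dim_𝕜 R/in(I) = dim_𝕜 R/I`. -/
theorem dilation_degeneration_degree
    (𝕜 : Type) [Field 𝕜] (n : ℕ) (I : Ideal (MvPolynomial (Fin n) 𝕜))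
    (hfin : FiniteDimensional 𝕜 (MvPolynomial (Fin n) 𝕜 ⧸ I)) :
    Module.finrank 𝕜 (MvPolynomial (Fin n) 𝕜 ⧸ inIdeal I) =
      Module.finrank 𝕜 (MvPolynomial (Fin n) 𝕜 ⧸ I) := by
  obtain ⟨S, hS⟩ := exists_isCompl_restrictSupport (inIdeal I)
  have hI := isCompl_restrictSupport_of_inIdeal hS
  exact LinearEquiv.finrank_eq
    ((Submodule.Quotient.restrictScalarsEquiv 𝕜 (inIdeal I)).symm ≪≫ₗ
      Submodule.quotientEquivOfIsCompl _ _ hS ≪≫ₗ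
      (Submodule.quotientEquivOfIsCompl _ _ hI).symm ≪≫ₗ
      Submodule.Quotient.restrictScalarsEquiv 𝕜 I)
end

section
/- Let R be a commutative local ring with maximal ideal 𝔪, and let M be a (finite) matrix over R. Let r ≥ 0 be an integer and suppose that every (r+1)×(r+1) minor of M lies in 𝔪 (equivalently, the reduction of M modulo 𝔪 has rank at most r over the residue field). Then for every integer t ≥ 1, every (r+t)×(r+t) minor of M lies in the ideal power 𝔪^t. -/
namespace Matrix

variable {R : Type*} [CommRing R]

theorem det_mem_of_det_submatrix_equiv_mem {m n : Type*} [Fintype m] [DecidableEq m]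
    [Fintype n] [DecidableEq n] {I : Ideal R} {A : Matrix m m R} (e₁ e₂ : n ≃ m)
    (h : (A.submatrix e₁ e₂).det ∈ I) : A.det ∈ I := by
  have key : A.submatrix e₁ e₂ = (A.submatrix id (e₁.symm.trans e₂)).submatrix e₁ e₁ := by
    ext; simp
  rw [key, det_submatrix_equiv_self, det_permute'] at h
  rcases Int.units_eq_one_or (Equiv.Perm.sign (e₁.symm.trans e₂)) with hs | hs <;>
    simpa [hs] using h

theorem det_mem_pow_card {n : Type*} [Fintype n] [DecidableEq n] {I : Ideal R}
    {A : Matrix n n R} (h : ∀ i j, A i j ∈ I) : A.det ∈ I ^ Fintype.card n := by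
  rw [det_apply]
  refine sum_mem fun σ _ => ?_
  have hp : ∏ i, A (σ i) i ∈ I ^ Fintype.card n := by
    have := Ideal.prod_mem_prod (s := Finset.univ) (I := fun _ : n => I)
      (x := fun i => A (σ i) i) fun i _ => h _ _
    simpa using this
  rcases Int.units_eq_one_or (Equiv.Perm.sign σ) with hs | hs <;> simpa [hs] using hp

theorem det_mem_of_forall_injective {ι κ n : Type*} [Fintype n] [DecidableEq n] {I : Ideal R}
    {M : Matrix ι κ R}
    (h : ∀ (ρ : n → ι) (γ : n → κ), Function.Injective ρ → Function.Injective γ →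
      (M.submatrix ρ γ).det ∈ I) (ρ : n → ι) (γ : n → κ) :
    (M.submatrix ρ γ).det ∈ I := by
  by_cases hρ : Function.Injective ρ
  · by_cases hγ : Function.Injective γ
    · exact h ρ γ hρ hγ
    · obtain ⟨i, j, hij, hne⟩ := Function.not_injective_iff.mp hγ
      rw [det_zero_of_column_eq hne fun k => by simp [hij]]
      exact I.zero_mem
  · obtain ⟨i, j, hij, hne⟩ := Function.not_injective_iff.mp hρ
    rw [det_zero_of_row_eq hne (by ext; simp [hij])]
    exact I.zero_mem

/-- Pivoting on a unit entry lowers both the size and the rank bound by one, until all entries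
lie in the maximal ideal. -/
theorem det_mem_maximalIdeal_pow [IsLocalRing R] {r t k : ℕ} (hk : k = r + t)
    (A : Matrix (Fin k) (Fin k) R)
    (h : ∀ ρ γ : Fin (r + 1) → Fin k,
      (A.submatrix ρ γ).det ∈ IsLocalRing.maximalIdeal R) :
    A.det ∈ IsLocalRing.maximalIdeal R ^ t := by
  induction r generalizing k with
  | zero =>
    have hA : ∀ i j, A i j ∈ IsLocalRing.maximalIdeal R := fun i j => by
      simpa using h (fun _ => i) fun _ => j
    simpa [hk] using det_mem_pow_card hA
  | succ r ih =>
    by_cases hA : ∀ i j, A i j ∈ IsLocalRing.maximalIdeal R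
    · exact Ideal.pow_le_pow_right (by simp [hk]) (det_mem_pow_card hA)
    push Not at hA
    obtain ⟨i, j, hij⟩ := hA
    obtain rfl : k = (r + t) + 1 := by omega
    let e (n : ℕ) (i : Fin (n + 1)) : Fin n ⊕ Unit ≃ Fin (n + 1) :=
      ((finSuccEquiv' i).trans (Equiv.optionEquivSumPUnit _)).symm
    have he : ∀ n i, e n i (Sum.inr ()) = i := fun n i => by simp [e]
    have hu : IsUnit (A i j) := by simpa using hij
    let B := A.submatrix (e _ i) (e _ j)
    have hB : IsUnit B.toBlocks₂₂.det := by simpa [B, toBlocks₂₂, he] using hu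
    let _ := B.toBlocks₂₂.invertibleOfIsUnitDet hB
    let S := B.toBlocks₁₁ - B.toBlocks₁₂ * ⅟B.toBlocks₂₂ * B.toBlocks₂₁
    refine det_mem_of_det_submatrix_equiv_mem (e _ i) (e _ j) ?_
    change B.det ∈ _
    rw [← fromBlocks_toBlocks B, det_fromBlocks₂₂]
    refine Ideal.mul_mem_left _ _ (ih rfl S fun ρ γ => ?_)
    have hminor : (B.submatrix (Sum.map ρ id) (Sum.map γ id)).det =
        B.toBlocks₂₂.det * (S.submatrix ρ γ).det := by
      have hblocks : B.submatrix (Sum.map ρ id) (Sum.map γ id) =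
          fromBlocks (B.toBlocks₁₁.submatrix ρ γ) (B.toBlocks₁₂.submatrix ρ id)
            (B.toBlocks₂₁.submatrix id γ) B.toBlocks₂₂ := by
        ext (a | a) (b | b) <;> rfl
      rw [hblocks, det_fromBlocks₂₂]
      rfl
    rw [← Ideal.unit_mul_mem_iff_mem _ hB, ← hminor,
      ← det_submatrix_equiv_self (e _ 0).symm]
    exact h (e _ i ∘ Sum.map ρ id ∘ (e _ 0).symm) (e _ j ∘ Sum.map γ id ∘ (e _ 0).symm)

end Matrix


/-- **Local-ring content of Lemma 4.4**: if every `(r+1) × (r+1)` minor of a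
matrix `M` over a commutative local ring lies in the maximal ideal `𝔪` (i.e. the
reduction of `M` mod `𝔪` has rank at most `r`), then every `(r+t) × (r+t)` minor
of `M` lies in `𝔪^t`. -/
theorem minors_in_maximalIdeal_pow
    (R : Type) [CommRing R] [IsLocalRing R]
    (ι κ : Type) [Fintype ι] [Fintype κ] [DecidableEq ι] [DecidableEq κ]
    (M : Matrix ι κ R) (r : ℕ)
    (h : ∀ (ρ : Fin (r + 1) → ι) (γ : Fin (r + 1) → κ),
      Function.Injective ρ → Function.Injective γ →
      (M.submatrix ρ γ).det ∈ IsLocalRing.maximalIdeal R) :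
    ∀ t : ℕ, 1 ≤ t →
      ∀ (ρ : Fin (r + t) → ι) (γ : Fin (r + t) → κ),
        Function.Injective ρ → Function.Injective γ →
        (M.submatrix ρ γ).det ∈ (IsLocalRing.maximalIdeal R) ^ t := by
  intro t _ ρ γ _ _
  exact Matrix.det_mem_maximalIdeal_pow rfl _ fun ρ' γ' =>
    Matrix.det_mem_of_forall_injective h (ρ ∘ ρ') (γ ∘ γ')
end

section
/- Let Λ be a Borel-fixed set of monomials in x₁,…,xₙ such that |Λ| ≥ binom(a, n), and let Λ₀ be the subset of Λ consisting of monomials in which the power of x₁ is 0. Then |Λ| − |Λ₀| ≥ binom(a−1, n). -/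
/-- A Borel-fixed set of monomials in `x₁,…,xₙ` (identified with exponent
vectors in `ℕⁿ`): a finite set closed under divisibility and under Borel moves
`x_j ↦ x_i` for `i < j`. -/
def BorelFixed {n : ℕ} (Λ : Finset (Fin n → ℕ)) : Prop :=
  (∀ lam ∈ Λ, ∀ mu : Fin n → ℕ, (∀ i, mu i ≤ lam i) → mu ∈ Λ) ∧
  (∀ lam ∈ Λ, ∀ i j : Fin n, i < j → 0 < lam j →
    (lam - Pi.single j 1 + Pi.single i 1) ∈ Λ)

namespace BorelFixed

/-- The exponent vectors of the monomials `m` such that `x₁ * m` belongs to `Λ`. -/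
noncomputable def divFirst {n : ℕ} (Λ : Finset (Fin (n + 1) → ℕ)) : Finset (Fin (n + 1) → ℕ) :=
  Λ.preimage (· + Pi.single 0 1) (add_left_injective _).injOn

/-- The monomials of `Λ` not divisible by `x₁`, as monomials in the remaining variables. -/
noncomputable def restrictTail {n : ℕ} (Λ : Finset (Fin (n + 1) → ℕ)) : Finset (Fin n → ℕ) :=
  Λ.preimage (fun v => (Fin.cons 0 v : Fin (n + 1) → ℕ))
    (Fin.cons_right_injective (α := fun _ => ℕ) 0).injOn

theorem mem_divFirst {n : ℕ} {Λ : Finset (Fin (n + 1) → ℕ)} {v : Fin (n + 1) → ℕ} :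
    v ∈ divFirst Λ ↔ v + Pi.single 0 1 ∈ Λ := by
  simp [divFirst]

theorem mem_restrictTail {n : ℕ} {Λ : Finset (Fin (n + 1) → ℕ)} {v : Fin n → ℕ} :
    v ∈ restrictTail Λ ↔ (Fin.cons 0 v : Fin (n + 1) → ℕ) ∈ Λ := by
  simp [restrictTail]

theorem card_divFirst_add_card_filter {n : ℕ} (Λ : Finset (Fin (n + 1) → ℕ)) :
    (divFirst Λ).card + (Λ.filter fun v => v 0 = 0).card = Λ.card := by
  classical
  have h : (divFirst Λ).card = (Λ.filter fun v => ¬ v 0 = 0).card := by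
    refine Finset.card_bij (fun v _ => v + Pi.single 0 1) ?_ ?_ ?_
    · intro v hv
      simpa using mem_divFirst.1 hv
    · intro v _ w _ hvw
      exact add_left_injective _ hvw
    · intro v hv
      obtain ⟨hv, hv0⟩ := Finset.mem_filter.1 hv
      have heq : v - Pi.single 0 1 + Pi.single 0 1 = v := by
        ext k
        by_cases hk : k = 0
        · subst hk
          simp
          omega
        · simp [hk]
      exact ⟨v - Pi.single 0 1, mem_divFirst.2 (heq.symm ▸ hv), heq⟩
  rw [h, add_comm]
  exact Finset.card_filter_add_card_filter_not _

theorem card_restrictTail {n : ℕ} (Λ : Finset (Fin (n + 1) → ℕ)) :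
    (restrictTail Λ).card = (Λ.filter fun v => v 0 = 0).card := by
  refine Finset.card_bij (fun v _ => (Fin.cons 0 v : Fin (n + 1) → ℕ)) ?_ ?_ ?_
  · intro v hv
    simpa using mem_restrictTail.1 hv
  · intro v _ w _ hvw
    exact Fin.cons_right_injective _ hvw
  · intro v hv
    obtain ⟨hv, hv0⟩ := Finset.mem_filter.1 hv
    have heq : (Fin.cons 0 (Fin.tail v) : Fin (n + 1) → ℕ) = v := by
      rw [← hv0, Fin.cons_self_tail]
    exact ⟨Fin.tail v, mem_restrictTail.2 (heq.symm ▸ hv), heq⟩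

theorem card_divFirst_add_card_restrictTail {n : ℕ} (Λ : Finset (Fin (n + 1) → ℕ)) :
    (divFirst Λ).card + (restrictTail Λ).card = Λ.card := by
  rw [card_restrictTail, card_divFirst_add_card_filter]

theorem divFirst_borelFixed {n : ℕ} {Λ : Finset (Fin (n + 1) → ℕ)} (hΛ : BorelFixed Λ) :
    BorelFixed (divFirst Λ) := by
  refine ⟨fun v hv w hwv => ?_, fun v hv i j hij hj => ?_⟩
  · exact mem_divFirst.2 <| hΛ.1 _ (mem_divFirst.1 hv) _ fun k => by
      simpa using hwv k
  · rw [mem_divFirst] at hv ⊢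
    convert hΛ.2 _ hv i j hij (by simp; omega) using 1
    ext k
    simp only [Pi.add_apply, Pi.sub_apply, Pi.single_apply]
    by_cases hk : k = j
    · subst hk
      simp
      omega
    · simp [hk]
      omega

theorem restrictTail_borelFixed {n : ℕ} {Λ : Finset (Fin (n + 1) → ℕ)} (hΛ : BorelFixed Λ) :
    BorelFixed (restrictTail Λ) := by
  refine ⟨fun v hv w hwv => ?_, fun v hv i j hij hj => ?_⟩
  · exact mem_restrictTail.2 <| hΛ.1 _ (mem_restrictTail.1 hv) _ fun k => by
      cases k using Fin.cases with
      | zero => simp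
      | succ k => simpa using hwv k
  · rw [mem_restrictTail] at hv ⊢
    convert hΛ.2 _ hv i.succ j.succ (by simpa using hij) (by simpa using hj) using 1
    ext k
    cases k using Fin.cases with
    | zero => simp [(Fin.succ_ne_zero _).symm]
    | succ k => simp [Pi.single_apply]

theorem divFirst_restrictTail_subset {n : ℕ} {Λ : Finset (Fin (n + 2) → ℕ)}
    (hΛ : BorelFixed Λ) : divFirst (restrictTail Λ) ⊆ restrictTail (divFirst Λ) := by
  intro v hv
  rw [mem_divFirst, mem_restrictTail] at hv
  rw [mem_restrictTail, mem_divFirst]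
  convert hΛ.2 _ hv 0 (Fin.succ 0) (Fin.succ_pos 0) (by rw [Fin.cons_succ]; simp) using 1
  ext k
  cases k using Fin.cases with
  | zero => simp
  | succ k => simp [Pi.single_apply, -Fin.succ_zero_eq_one, -Fin.succ_zero_eq_one']

theorem choose_le_card_of_choose_le_card_restrictTail {n : ℕ}
    (ih : ∀ (a : ℕ) (Λ : Finset (Fin (n + 1) → ℕ)), BorelFixed Λ →
      a.choose (n + 1) ≤ Λ.card → (a - 1).choose (n + 1) ≤ (divFirst Λ).card)
    (b : ℕ) (Λ : Finset (Fin (n + 2) → ℕ)) (hΛ : BorelFixed Λ)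
    (hcard : b.choose (n + 1) ≤ (restrictTail Λ).card) :
    (b + 1).choose (n + 2) ≤ Λ.card := by
  induction b generalizing Λ with
  | zero => simp [Nat.choose_eq_zero_of_lt]
  | succ b ihb =>
    have h₁ := ihb _ (divFirst_borelFixed hΛ) <|
      (ih _ _ (restrictTail_borelFixed hΛ) hcard).trans
        (Finset.card_le_card (divFirst_restrictTail_subset hΛ))
    have h₂ := card_divFirst_add_card_restrictTail Λ
    have h₃ : (b + 1 + 1).choose (n + 2) = (b + 1).choose (n + 1) + (b + 1).choose (n + 2) :=
      Nat.choose_succ_succ' (b + 1) (n + 1)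
    omega

theorem choose_le_card_divFirst {n : ℕ} (a : ℕ) (Λ : Finset (Fin (n + 1) → ℕ))
    (hΛ : BorelFixed Λ) (hcard : a.choose (n + 1) ≤ Λ.card) :
    (a - 1).choose (n + 1) ≤ (divFirst Λ).card := by
  induction n generalizing a with
  | zero =>
    have h₁ := card_divFirst_add_card_restrictTail Λ
    have h₂ : (restrictTail Λ).card ≤ 1 := Finset.card_le_one_of_subsingleton _
    simp only [zero_add, Nat.choose_one_right] at hcard ⊢
    omega
  | succ n ih =>
    rcases a with _ | _ | b
    · simp
    · simp
    · simp only [Nat.add_sub_cancel]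
      by_cases h : (b + 1).choose (n + 1) ≤ (restrictTail Λ).card
      · exact choose_le_card_of_choose_le_card_restrictTail ih _ _ (divFirst_borelFixed hΛ) <|
          (ih _ _ (restrictTail_borelFixed hΛ) h).trans
            (Finset.card_le_card (divFirst_restrictTail_subset hΛ))
      · have h₂ := card_divFirst_add_card_restrictTail Λ
        have h₃ := Nat.choose_succ_succ' (b + 1) (n + 1)
        omega

end BorelFixed

/-- **Lemma 5.4**: for a Borel-fixed set of monomials `Λ` with
`|Λ| ≥ binom(a,n)`, letting `Λ₀` be the monomials of `Λ` not divisible by `x₁`,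
one has `|Λ| − |Λ₀| ≥ binom(a−1, n)`. -/
theorem borel_frontier_lemma (n a : ℕ) [NeZero n] (Λ : Finset (Fin n → ℕ))
    (hB : BorelFixed Λ) (hcard : Nat.choose a n ≤ Λ.card) :
    Nat.choose (a - 1) n ≤ Λ.card - (Λ.filter fun lam => lam 0 = 0).card := by
  obtain ⟨m, rfl⟩ := Nat.exists_eq_succ_of_ne_zero (NeZero.ne n)
  have h₁ := BorelFixed.choose_le_card_divFirst a Λ hB hcard
  have h₂ := BorelFixed.card_divFirst_add_card_filter Λ
  exact h₁.trans (Nat.le_sub_of_add_le h₂.le)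
end
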